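/- For every r ∈ (2, ∞) there exists a constant C_r > 0 depending only on r such that for every n and every function f : 𝕀^n → ℂ whose Fourier transform satisfies f̂(y) = 0 whenever |y| > n/2, one has ‖V_r(S_k f : k ∈ {0,1,...,n})‖_2 ≤ C_r ‖f‖_2. -/

import Mathlib

open scoped ENNReal
/-- The spherical mean of radius `k` on the hypercube `{0,1}^n`. -/
noncomputable def sphMean (n k : ℕ) (f : (Fin n → Bool) → ℂ) (x : Fin n → Bool) : ℂ :=
  ((n.choose k : ℂ))⁻¹ * ∑ y ∈ Finset.univ.filter (fun y => hammingDist x y = k), f y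

/-- The `r`-variation seminorm of `a` over the index set `Z`, valued in `[0,∞]`. -/
noncomputable def eVar {ι : Type*} [LinearOrder ι] (r : ℝ) (a : ι → ℂ) (Z : Set ι) : ℝ≥0∞ :=
  ⨆ (J : ℕ) (t : Fin (J + 1) → ι) (_ : StrictMono t) (_ : ∀ j, t j ∈ Z),
    (∑ j : Fin J, (ENNReal.ofReal ‖a (t j.castSucc) - a (t j.succ)‖) ^ r) ^ r⁻¹

/-- The `ℓ²` norm of a `[0,∞]`-valued function on the hypercube. -/
noncomputable def eL2 {n : ℕ} (V : (Fin n → Bool) → ℝ≥0∞) : ℝ≥0∞ :=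
  (∑ x : Fin n → Bool, V x ^ (2 : ℝ)) ^ ((2 : ℝ))⁻¹

/-- The `ℓ²` norm of a complex function on the hypercube. -/
noncomputable def l2Norm {n : ℕ} (f : (Fin n → Bool) → ℂ) : ℝ :=
  Real.sqrt (∑ x : Fin n → Bool, ‖f x‖ ^ 2)

/-- The length (number of ones) of an element of the hypercube. -/
def wt {n : ℕ} (x : Fin n → Bool) : ℕ := (Finset.univ.filter (fun j => x j = true)).card

/-- The character `χ_y(x) = (-1)^{x·y}` on the hypercube. -/
noncomputable def chi {n : ℕ} (y x : Fin n → Bool) : ℂ :=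
  (-1) ^ ((Finset.univ.filter (fun j => x j = true ∧ y j = true)).card)

/-- The Fourier transform on the hypercube: `f̂(y) = 2^{-n/2} ∑_x f(x) χ_y(x)`. -/
noncomputable def fourierT {n : ℕ} (f : (Fin n → Bool) → ℂ) (y : Fin n → Bool) : ℂ :=
  ((Real.sqrt (2 ^ n) : ℂ))⁻¹ * ∑ x : Fin n → Bool, f x * chi y x
/-- Variation bound. -/
def VarLE (r : ℝ) (N : ℕ) (a : ℕ → ℂ) (B : ℝ) : Prop :=
  ∀ (J : ℕ) (t : ℕ → ℕ), Monotone t → (∀ j, t j ≤ N) →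
    ∑ j ∈ Finset.range J, ‖a (t (j+1)) - a (t j)‖ ^ r ≤ B ^ r

noncomputable def rmax (a : ℕ → ℂ) : ℕ → ℝ
  | 0 => ‖a 0‖
  | (i+1) => max (rmax a i) ‖a (i+1)‖

open Classical in
noncomputable def anch (ε : ℝ) (a : ℕ → ℂ) : ℕ → ℂ
  | 0 => a 0
  | (i+1) => if ε * rmax a (i+1) ≤ ‖a (i+1) - anch ε a i‖ then a (i+1) else anch ε a i

open Classical in
noncomputable def cst (ε : ℝ) (a : ℕ → ℂ) (i : ℕ) : ℝ :=
  if ε * rmax a (i+1) ≤ ‖a (i+1) - anch ε a i‖ then ‖a (i+1) - anch ε a i‖^2 else 0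

lemma rmax_mono (a : ℕ → ℂ) : Monotone (rmax a) :=
  monotone_nat_of_le_succ (fun i => by simp [rmax])

lemma le_rmax (a : ℕ → ℂ) (i : ℕ) : ‖a i‖ ≤ rmax a i := by
  cases i <;> simp [rmax]

lemma rmax_nonneg (a : ℕ → ℂ) (i : ℕ) : 0 ≤ rmax a i := (norm_nonneg _).trans (le_rmax a i)

lemma cst_nonneg (ε : ℝ) (a : ℕ → ℂ) (i : ℕ) : 0 ≤ cst ε a i := by
  unfold cst; split_ifs <;> positivity

lemma anch_le (ε : ℝ) (a : ℕ → ℂ) (i : ℕ) : ‖anch ε a i‖ ≤ rmax a i := by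
  induction i with
  | zero => simp [rmax, anch]
  | succ i ih =>
    rw [anch]; split_ifs
    · exact le_rmax a _
    · exact ih.trans (rmax_mono a (Nat.le_succ i))

lemma anch_close (ε : ℝ) (hε : 0 ≤ ε) (a : ℕ → ℂ) (i : ℕ) : ‖a i - anch ε a i‖ ≤ ε * rmax a i := by
  cases i with
  | zero => simp only [anch, sub_self, norm_zero]; exact mul_nonneg hε (rmax_nonneg _ _)
  | succ i =>
    rw [anch]; split_ifs with h
    · simpa using mul_nonneg hε (rmax_nonneg _ _)
    · exact (not_le.1 h).le

lemma exists_rmax (a : ℕ → ℂ) (s : ℕ) : ∀ t, s ≤ t → rmax a s < rmax a t →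
    ∃ i, s ≤ i ∧ i < t ∧ ‖a (i+1)‖ = rmax a t ∧ rmax a (i+1) = rmax a t := by
  intro t hst
  induction t, hst using Nat.le_induction with
  | base => intro h; exact absurd h (lt_irrefl _)
  | succ t hst ih =>
    intro h
    by_cases h1 : rmax a t < ‖a (t+1)‖
    · refine ⟨t, hst, by omega, ?_, rfl⟩
      rw [rmax, max_eq_right h1.le]
    · have e : rmax a (t+1) = rmax a t := by rw [rmax, max_eq_left (not_lt.1 h1)]
      rw [e] at h ⊢
      obtain ⟨i, h1, h2, h3⟩ := ih h
      exact ⟨i, h1, by omega, h3⟩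

lemma path_aux (ε : ℝ) (h0 : 0 < ε) (h1 : ε ≤ 1/2) (a : ℕ → ℂ) (s t : ℕ) (hst : s ≤ t)
    (hM : 0 < rmax a t) (h : 2 * ε * rmax a t < ‖a t - a s‖) :
    ∃ i, s ≤ i ∧ i < t ∧ ε * rmax a (i+1) ≤ ‖a (i+1) - anch ε a i‖ ∧ rmax a t / 2 ≤ rmax a (i+1) := by
  by_contra hcon
  push Not at hcon
  by_cases hs : rmax a t / 2 ≤ rmax a s
  · have hc : ∀ i, s ≤ i → i ≤ t → anch ε a i = anch ε a s := by
      intro i hi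
      induction i, hi using Nat.le_induction with
      | base => intro; rfl
      | succ i hi ih =>
        intro hit
        rw [anch, if_neg, ih (by omega)]
        intro hj
        have := hcon i hi (by omega) hj
        have := rmax_mono a (show s ≤ i+1 by omega)
        linarith
    have e := hc t hst le_rfl
    have c1 := anch_close ε h0.le a t
    have c2 := anch_close ε h0.le a s
    rw [e] at c1
    have m1 := mul_le_mul_of_nonneg_left (rmax_mono a hst) h0.le
    have : ‖a t - a s‖ ≤ ‖a t - anch ε a s‖ + ‖a s - anch ε a s‖ := by
      rw [← norm_neg (a s - _)]
      refine le_trans (le_of_eq ?_) (norm_add_le _ _)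
      congr 1; ring
    linarith
  · push Not at hs
    have hc : ∀ i, s ≤ i → i ≤ t → ‖anch ε a i‖ < rmax a t / 2 := by
      intro i hi
      induction i, hi using Nat.le_induction with
      | base => intro; exact (anch_le ε a s).trans_lt hs
      | succ i hi ih =>
        intro hit
        rw [anch]; split_ifs with hj
        · exact (le_rmax a _).trans_lt (hcon i hi (by omega) hj)
        · exact ih (by omega)
    obtain ⟨i, i1, i2, i3, i4⟩ := exists_rmax a s t hst (by linarith)
    by_cases hj : ε * rmax a (i+1) ≤ ‖a (i+1) - anch ε a i‖
    · have := hcon i i1 i2 hj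
      linarith
    · push Not at hj
      have := hc i i1 i2.le
      have h3 := norm_sub_norm_le (a (i+1)) (anch ε a i)
      rw [i4] at hj
      have := mul_le_mul_of_nonneg_right h1 hM.le
      linarith

lemma path_cost (ε : ℝ) (h0 : 0 < ε) (h1 : ε ≤ 1/2) (a : ℕ → ℂ) (s t : ℕ) (hst : s ≤ t)
    (hM : 0 < rmax a t) (h : 2 * ε * rmax a t < ‖a t - a s‖) :
    (ε * rmax a t)^2 ≤ 4 * ∑ i ∈ Finset.Ico s t, cst ε a i := by
  obtain ⟨i, i1, i2, i3, i4⟩ := path_aux ε h0 h1 a s t hst hM h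
  have : cst ε a i ≤ ∑ i ∈ Finset.Ico s t, cst ε a i :=
    Finset.single_le_sum (f := cst ε a) (fun i _ => cst_nonneg ε a i) (Finset.mem_Ico.2 ⟨i1, i2⟩)
  have hc : cst ε a i = ‖a (i+1) - anch ε a i‖^2 := by rw [cst, if_pos i3]
  have : (ε * rmax a (i+1))^2 ≤ ‖a (i+1) - anch ε a i‖^2 :=
    pow_le_pow_left₀ (mul_nonneg h0.le (rmax_nonneg _ _)) i3 2
  have h5 : (ε * (rmax a t / 2))^2 ≤ (ε * rmax a (i+1))^2 :=
    pow_le_pow_left₀ (by positivity) (mul_le_mul_of_nonneg_left i4 h0.le) 2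
  nlinarith

/-- dyadic choice -/
lemma exists_dyadic (y : ℝ) (h0 : 0 < y) (h2 : y ≤ 2) :
    ∃ m : ℕ, 2 * (1/2:ℝ)^(m+1) < y ∧ y ≤ 4 * (1/2:ℝ)^(m+1) := by
  obtain ⟨m, hm, hm'⟩ := exists_nat_pow_near_of_lt_one (x := y/2) (y := (1/2:ℝ)) (by positivity) (by linarith) (by norm_num) (by norm_num)
  refine ⟨m, ?_, ?_⟩
  · linarith
  · rw [pow_succ]; linarith

lemma path_pair (r : ℝ) (hr : 2 < r) (a : ℕ → ℂ) (s t N : ℕ) (hst : s ≤ t) (htN : t ≤ N)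
    (h : a t ≠ a s) : ∃ m : ℕ, ‖a t - a s‖ ^ r ≤ 64 * 4 ^ (r-2) * ((rmax a N) ^ (r-2) *
      (((1/2:ℝ)^(r-2))^(m+1) * ∑ i ∈ Finset.Ico s t, cst ((1/2)^(m+1)) a i)) := by
  have hd : 0 < ‖a t - a s‖ := norm_pos_iff.2 (sub_ne_zero.2 h)
  have hd2 : ‖a t - a s‖ ≤ 2 * rmax a t := by
    have := norm_sub_le (a t) (a s)
    have := le_rmax a t
    have := (le_rmax a s).trans (rmax_mono a hst)
    linarith
  have hM : 0 < rmax a t := by linarith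
  obtain ⟨m, m1, m2⟩ := exists_dyadic (‖a t - a s‖ / rmax a t) (by positivity)
    (by rw [div_le_iff₀ hM]; exact hd2)
  refine ⟨m, ?_⟩
  set ε : ℝ := (1/2:ℝ)^(m+1) with hε
  have e0 : 0 < ε := by positivity
  have e1 : ε ≤ 1/2 := by
    rw [hε, pow_succ]
    have : (1/2:ℝ)^m ≤ 1 := pow_le_one₀ (by norm_num) (by norm_num)
    linarith
  rw [lt_div_iff₀ hM] at m1
  rw [div_le_iff₀ hM] at m2
  have pc := path_cost ε e0 e1 a s t hst hM m1
  have hS : 0 ≤ ∑ i ∈ Finset.Ico s t, cst ε a i := Finset.sum_nonneg (fun i _ => cst_nonneg ε a i)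
  have hr2 : ((1/2:ℝ)^(r-2))^(m+1) = ε ^ (r-2) := by
    rw [hε, ← Real.rpow_natCast, ← Real.rpow_mul (by norm_num), ← Real.rpow_natCast, ← Real.rpow_mul (by norm_num), mul_comm]
  rw [hr2]
  have hsplit : ‖a t - a s‖ ^ r = ‖a t - a s‖ ^ (r-2) * ‖a t - a s‖ ^ 2 := by
    rw [← Real.rpow_natCast, ← Real.rpow_add hd]; norm_num
  have hb1 : ‖a t - a s‖ ^ (r-2) ≤ (4 * ε * rmax a N) ^ (r-2) := by
    apply Real.rpow_le_rpow hd.le _ (by linarith)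
    refine m2.trans (mul_le_mul_of_nonneg_left (rmax_mono a htN) (by positivity))
  have hb2 : ‖a t - a s‖ ^ 2 ≤ 64 * ∑ i ∈ Finset.Ico s t, cst ε a i := by
    have : ‖a t - a s‖ ^ 2 ≤ (4 * ε * rmax a t)^2 := pow_le_pow_left₀ hd.le m2 2
    nlinarith
  have hN := rmax_nonneg a N
  rw [hsplit]
  calc _ ≤ (4 * ε * rmax a N) ^ (r-2) * (64 * ∑ i ∈ Finset.Ico s t, cst ε a i) := by
        apply mul_le_mul hb1 hb2 (by positivity) (by positivity)
    _ = _ := by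
        rw [Real.mul_rpow (by positivity) hN, Real.mul_rpow (by norm_num) e0.le]; ring

lemma sum_Ico_mono (c : ℕ → ℝ) (t : ℕ → ℕ) (ht : Monotone t) (J : ℕ) :
    ∑ j ∈ Finset.range J, ∑ i ∈ Finset.Ico (t j) (t (j+1)), c i = ∑ i ∈ Finset.Ico (t 0) (t J), c i := by
  induction J with
  | zero => simp
  | succ J ih =>
    rw [Finset.sum_range_succ, ih, Finset.sum_Ico_consecutive _ (ht (Nat.zero_le _)) (ht (Nat.le_succ _))]

lemma path_var (r : ℝ) (hr : 2 < r) (a : ℕ → ℂ) (N : ℕ) : ∃ L0 : ℕ, ∀ L, L0 ≤ L →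
    VarLE r N a (Real.sqrt (((64 * 4 ^ (r-2)) ^ (2/r)) * ((rmax a N)^2 + ∑ m ∈ Finset.range L,
      ((1/2:ℝ)^(r-2))^(m+1) * ∑ i ∈ Finset.range N, cst ((1/2)^(m+1)) a i))) := by
  have hr0 : 0 < r := by linarith
  have hw : 0 ≤ ((1/2:ℝ)^(r-2)) := by positivity
  have hN := rmax_nonneg a N
  choose m hm using path_pair r hr a
  classical
  let mm : ℕ × ℕ → ℕ := fun p => if h : p.1 ≤ p.2 ∧ p.2 ≤ N ∧ a p.2 ≠ a p.1 then m p.1 p.2 N h.1 h.2.1 h.2.2 else 0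
  refine ⟨(Finset.range (N+1) ×ˢ Finset.range (N+1)).sup mm + 1, ?_⟩
  intro L hL J t ht htN
  set Z := ∑ m ∈ Finset.range L, ((1/2:ℝ)^(r-2))^(m+1) * ∑ i ∈ Finset.range N, cst ((1/2)^(m+1)) a i with hZ
  have hZ0 : 0 ≤ Z := Finset.sum_nonneg fun i _ => mul_nonneg (by positivity) (Finset.sum_nonneg fun i _ => cst_nonneg _ _ _)
  have key : ∑ j ∈ Finset.range J, ‖a (t (j+1)) - a (t j)‖ ^ r ≤ 64 * 4 ^ (r-2) * ((rmax a N) ^ (r-2) * Z) := by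
    calc _ ≤ ∑ j ∈ Finset.range J, 64 * 4 ^ (r-2) * ((rmax a N) ^ (r-2) * ∑ m ∈ Finset.range L,
          ((1/2:ℝ)^(r-2))^(m+1) * ∑ i ∈ Finset.Ico (t j) (t (j+1)), cst ((1/2)^(m+1)) a i) := by
          apply Finset.sum_le_sum
          intro j _
          have hnn : ∀ m ∈ Finset.range L, 0 ≤ ((1/2:ℝ)^(r-2))^(m+1) * ∑ i ∈ Finset.Ico (t j) (t (j+1)), cst ((1/2)^(m+1)) a i :=
            fun i _ => mul_nonneg (by positivity) (Finset.sum_nonneg fun i _ => cst_nonneg _ _ _)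
          by_cases hne : a (t (j+1)) = a (t j)
          · rw [hne, sub_self, norm_zero, Real.zero_rpow hr0.ne']
            exact mul_nonneg (by positivity) (mul_nonneg (by positivity) (Finset.sum_nonneg hnn))
          · have h1 : t j ≤ t (j+1) := ht (Nat.le_succ j)
            refine (hm _ _ N h1 (htN _) hne).trans ?_
            apply mul_le_mul_of_nonneg_left _ (by positivity)
            apply mul_le_mul_of_nonneg_left _ (by positivity)
            apply Finset.single_le_sum hnn
            rw [Finset.mem_range]
            have : mm (t j, t (j+1)) ≤ _ := Finset.le_sup (f := mm) (s := Finset.range (N+1) ×ˢ Finset.range (N+1)) (b := (t j, t (j+1)))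
              (by simp only [Finset.mem_product, Finset.mem_range]; exact ⟨Nat.lt_succ_of_le (htN _), Nat.lt_succ_of_le (htN _)⟩)
            have e : mm (t j, t (j+1)) = m (t j) (t (j+1)) N h1 (htN _) hne := by
              simp only [mm]; rw [dif_pos ⟨h1, htN _, hne⟩]
            omega
      _ = 64 * 4 ^ (r-2) * ((rmax a N) ^ (r-2) * ∑ m ∈ Finset.range L,
          ((1/2:ℝ)^(r-2))^(m+1) * ∑ i ∈ Finset.Ico (t 0) (t J), cst ((1/2)^(m+1)) a i) := by
          rw [← Finset.mul_sum, ← Finset.mul_sum, Finset.sum_comm]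
          congr 2
          apply Finset.sum_congr rfl
          intro m _
          rw [← Finset.mul_sum, sum_Ico_mono _ _ ht]
      _ ≤ _ := by
          apply mul_le_mul_of_nonneg_left _ (by positivity)
          apply mul_le_mul_of_nonneg_left _ (by positivity)
          apply Finset.sum_le_sum
          intro m _
          apply mul_le_mul_of_nonneg_left _ (by positivity)
          apply Finset.sum_le_sum_of_subset_of_nonneg
          · intro i hi
            rw [Finset.mem_Ico] at hi
            exact Finset.mem_range.2 (hi.2.trans_le (htN _))
          · intro i _ _; exact cst_nonneg _ _ _
  refine key.trans ?_
  set U := (rmax a N)^2 + Z with hU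
  have hU0 : 0 ≤ U := by positivity
  rw [Real.sqrt_eq_rpow, ← Real.rpow_mul (by positivity), Real.mul_rpow (by positivity) hU0, ← Real.rpow_mul (by positivity)]
  have e1 : 2 / r * (1/2 * r) = 1 := by field_simp
  rw [e1, Real.rpow_one]
  apply mul_le_mul_of_nonneg_left _ (by positivity)
  by_cases hUz : U = 0
  · have : Z = 0 := by nlinarith [sq_nonneg (rmax a N)]
    rw [this]; simp; positivity
  have hUp : 0 < U := lt_of_le_of_ne hU0 (Ne.symm hUz)
  have hZU : Z ≤ U := by nlinarith [sq_nonneg (rmax a N)]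
  have hMU : (rmax a N)^(r-2) ≤ U^((r-2)/2) := by
    have : rmax a N ≤ Real.sqrt U := Real.le_sqrt_of_sq_le (by linarith)
    calc _ ≤ (Real.sqrt U)^(r-2) := Real.rpow_le_rpow hN this (by linarith)
      _ = _ := by rw [Real.sqrt_eq_rpow, ← Real.rpow_mul hU0]; congr 1; ring
  calc _ ≤ U^((r-2)/2) * U := mul_le_mul hMU hZU hZ0 (by positivity)
    _ = U^((r-2)/2+1) := by rw [Real.rpow_add hUp, Real.rpow_one]
    _ = _ := by congr 1; ring

def MartH {Ω : Type*} [Fintype Ω] (N : ℕ) (g : ℕ → Ω → ℂ) : Prop :=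
  ∀ i < N, ∀ φ : Ω → ℂ, (∀ x x', (∀ j ≤ i, g j x = g j x') → φ x = φ x') →
    ∑ x, φ x * (g (i+1) x - g i x) = 0

section mart
variable {Ω : Type*} [Fintype Ω] (N : ℕ) (g : ℕ → Ω → ℂ) 

lemma rmax_congr (a b : ℕ → ℂ) (i : ℕ) (h : ∀ j ≤ i, a j = b j) : rmax a i = rmax b i := by
  induction i with
  | zero => simp [rmax, h 0 le_rfl]
  | succ i ih => rw [rmax, rmax, ih (fun j hj => h j (by omega)), h (i+1) le_rfl]

lemma anch_congr (ε : ℝ) (a b : ℕ → ℂ) (i : ℕ) (h : ∀ j ≤ i, a j = b j) : anch ε a i = anch ε b i := by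
  induction i with
  | zero => simp [anch, h 0 le_rfl]
  | succ i ih => rw [anch, anch, ih (fun j hj => h j (by omega)), h (i+1) le_rfl, rmax_congr a b _ h]

lemma mart_orth (H : MartH N g) (i : ℕ) (hi : i < N) (u : Ω → ℂ)
    (hu : ∀ x x', (∀ j ≤ i, g j x = g j x') → u x = u x') :
    ∑ x, ‖g (i+1) x - u x‖^2 = ∑ x, ‖g (i+1) x - g i x‖^2 + ∑ x, ‖g i x - u x‖^2 := by
  have h1 := H i hi (fun x => (starRingEnd ℂ) (g i x - u x)) (by
    intro x x' h; simp only [hu x x' h, h i le_rfl])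
  have h2 := congrArg Complex.re h1
  rw [Complex.re_sum, Complex.zero_re] at h2
  have : ∀ x, ‖g (i+1) x - u x‖^2 = ‖g (i+1) x - g i x‖^2 + ‖g i x - u x‖^2 + 2 * ((starRingEnd ℂ) (g i x - u x) * (g (i+1) x - g i x)).re := by
    intro x
    simp only [← Complex.normSq_eq_norm_sq, Complex.normSq_apply, Complex.mul_re, Complex.conj_re, Complex.conj_im, Complex.sub_re, Complex.sub_im]
    ring
  rw [Finset.sum_congr rfl (fun x _ => this x), Finset.sum_add_distrib, Finset.sum_add_distrib, ← Finset.mul_sum, h2]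
  ring

lemma cost_step (ε : ℝ) (a : ℕ → ℂ) (i : ℕ) :
    ‖a (i+1) - anch ε a (i+1)‖^2 + cst ε a i = ‖a (i+1) - anch ε a i‖^2 := by
  rw [anch, cst]; split_ifs <;> simp

lemma cost_bound (H : MartH N g) (ε : ℝ) (i : ℕ) (hi : i ≤ N) :
    ∑ x, ‖g i x - anch ε (fun j => g j x) i‖^2 + ∑ x, ∑ k ∈ Finset.range i, cst ε (fun j => g j x) k
      ≤ ∑ x, ‖g i x‖^2 := by
  induction i with
  | zero => simp [anch]; exact Finset.sum_nonneg fun _ _ => by positivity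
  | succ i ih =>
    have ih := ih (by omega)
    have h1 := mart_orth N g H i (by omega) (fun _ => 0) (fun _ _ _ => rfl)
    have h2 := mart_orth N g H i (by omega) (fun x => anch ε (fun j => g j x) i)
      (fun x x' h => anch_congr ε _ _ i h)
    simp only [sub_zero] at h1
    simp only [Finset.sum_range_succ, Finset.sum_add_distrib] at ih ⊢
    have h3 : ∑ x, ‖g (i+1) x - anch ε (fun j => g j x) (i+1)‖^2 + ∑ x, cst ε (fun j => g j x) i = ∑ x, ‖g (i+1) x - anch ε (fun j => g j x) i‖^2 := by
      rw [← Finset.sum_add_distrib]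
      exact Finset.sum_congr rfl (fun x _ => cost_step ε (fun j => g j x) i)
    linarith

lemma submart (H : MartH N g) (i : ℕ) (hi : i < N) :
    ∑ x, rmax (fun j => g j x) i * ‖g i x‖ ≤ ∑ x, rmax (fun j => g j x) i * ‖g (i+1) x‖ := by
  have h1 := H i hi (fun x => (rmax (fun j => g j x) i : ℂ) * ((starRingEnd ℂ) (g i x) / (‖g i x‖ : ℂ))) (by
    intro x x' h; simp only [rmax_congr _ _ i h, h i le_rfl])
  simp only [mul_sub] at h1
  rw [Finset.sum_sub_distrib, sub_eq_zero] at h1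
  have h2 : ∑ x, (rmax (fun j => g j x) i : ℂ) * ((starRingEnd ℂ) (g i x) / (‖g i x‖ : ℂ)) * g i x = ((∑ x, rmax (fun j => g j x) i * ‖g i x‖ : ℝ) : ℂ) := by
    push_cast
    apply Finset.sum_congr rfl
    intro x _
    by_cases hz : g i x = 0
    · simp [hz]
    · have : (‖g i x‖ : ℂ) ≠ 0 := by simpa using hz
      have h3 : (starRingEnd ℂ) (g i x) * g i x = (‖g i x‖ : ℂ)^2 := by
        rw [mul_comm]; exact Complex.mul_conj' _
      field_simp
      linear_combination (rmax (fun j => g j x) i : ℂ) * h3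
  rw [h2] at h1
  have h4 := congrArg norm h1
  have h5 : 0 ≤ ∑ x, rmax (fun j => g j x) i * ‖g i x‖ := Finset.sum_nonneg fun x _ => mul_nonneg (rmax_nonneg _ _) (norm_nonneg _)
  rw [Complex.norm_of_nonneg h5] at h4
  rw [← h4]
  refine (norm_sum_le _ _).trans (Finset.sum_le_sum fun x _ => ?_)
  rw [norm_mul, norm_mul, Complex.norm_of_nonneg (rmax_nonneg _ _), norm_div]
  apply mul_le_mul_of_nonneg_right _ (norm_nonneg _)
  simp only [Complex.norm_conj, Complex.norm_real, norm_norm]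
  exact mul_le_of_le_one_right (rmax_nonneg _ _) (div_self_le_one _)

lemma doob (H : MartH N g) : ∑ x, (rmax (fun j => g j x) N)^2 ≤ 4 * ∑ x, ‖g N x‖^2 := by
  have key : ∀ i ≤ N, ∑ x, (rmax (fun j => g j x) i)^2 ≤ 2 * ∑ x, rmax (fun j => g j x) i * ‖g i x‖ := by
    intro i hi
    induction i with
    | zero =>
      rw [Finset.mul_sum]
      apply Finset.sum_le_sum
      intro x _
      simp only [rmax]; nlinarith [norm_nonneg (g 0 x)]
    | succ i ih =>
      have ih := ih (by omega)
      have h1 := submart N g H i (by omega)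
      have h2 : ∑ x, ((rmax (fun j => g j x) (i+1))^2 - 2 * (rmax (fun j => g j x) (i+1) * ‖g (i+1) x‖)) ≤ ∑ x, ((rmax (fun j => g j x) i)^2 - 2 * (rmax (fun j => g j x) i * ‖g (i+1) x‖)) := by
        apply Finset.sum_le_sum
        intro x _
        rw [rmax]
        rcases max_cases (rmax (fun j => g j x) i) ‖g (i+1) x‖ with h | h <;> rw [h.1]
        nlinarith [sq_nonneg (rmax (fun j => g j x) i - ‖g (i+1) x‖)]
      simp only [Finset.sum_sub_distrib, ← Finset.mul_sum] at h2
      linarith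
  have h1 := key N le_rfl
  have h2 : 2 * ∑ x, rmax (fun j => g j x) N * ‖g N x‖ ≤ ∑ x, ((1/2) * (rmax (fun j => g j x) N)^2 + 2 * ‖g N x‖^2) := by
    rw [Finset.mul_sum]
    apply Finset.sum_le_sum
    intro x _
    nlinarith [sq_nonneg (rmax (fun j => g j x) N - 2 * ‖g N x‖)]
  rw [Finset.sum_add_distrib, ← Finset.mul_sum, ← Finset.mul_sum] at h2
  linarith

lemma geom_sum_succ_le (w : ℝ) (h0 : 0 ≤ w) (h1 : w < 1) (L : ℕ) : ∑ m ∈ Finset.range L, w^(m+1) ≤ 1/(1-w) := by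
  have h2 : ∑ m ∈ Finset.range L, w^m = (1 - w^L)/(1-w) := by
    rw [geom_sum_eq h1.ne, ← neg_div_neg_eq]; simp
  have h3 : ∑ m ∈ Finset.range L, w^(m+1) ≤ ∑ m ∈ Finset.range L, w^m :=
    Finset.sum_le_sum fun m _ => pow_le_pow_of_le_one h0 h1.le (Nat.le_succ m)
  refine h3.trans ?_
  rw [h2]
  have : 0 ≤ w^L := by positivity
  have : 0 < 1 - w := by linarith
  gcongr
  linarith

theorem lepingle (r : ℝ) (hr : 2 < r) (H : MartH N g) : ∃ B : Ω → ℝ, (∀ x, 0 ≤ B x) ∧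
    ∑ x, (B x)^2 ≤ ((64 * 4 ^ (r-2)) ^ (2/r) * (4 + 1/(1-(1/2:ℝ)^(r-2)))) * ∑ x, ‖g N x‖^2 ∧
    ∀ x, VarLE r N (fun i => g i x) (B x) := by
  choose L0 hL0 using fun x => path_var r hr (fun i => g i x) N
  set L := Finset.univ.sup L0
  refine ⟨_, fun x => Real.sqrt_nonneg _, ?_, fun x => hL0 x L (Finset.le_sup (Finset.mem_univ x))⟩
  have hw : 0 ≤ ((1/2:ℝ)^(r-2)) := by positivity
  have hw1 : ((1/2:ℝ)^(r-2)) < 1 := Real.rpow_lt_one (by norm_num) (by norm_num) (by linarith)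
  have : ∀ x, (Real.sqrt (((64 * 4 ^ (r-2)) ^ (2/r)) * ((rmax (fun i => g i x) N)^2 + ∑ m ∈ Finset.range L,
      ((1/2:ℝ)^(r-2))^(m+1) * ∑ i ∈ Finset.range N, cst ((1/2)^(m+1)) (fun i => g i x) i)))^2 = ((64 * 4 ^ (r-2)) ^ (2/r)) * ((rmax (fun i => g i x) N)^2 + ∑ m ∈ Finset.range L,
      ((1/2:ℝ)^(r-2))^(m+1) * ∑ i ∈ Finset.range N, cst ((1/2)^(m+1)) (fun i => g i x) i) := by
    intro x
    apply Real.sq_sqrt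
    have : 0 ≤ ∑ m ∈ Finset.range L,
      ((1/2:ℝ)^(r-2))^(m+1) * ∑ i ∈ Finset.range N, cst ((1/2)^(m+1)) (fun i => g i x) i :=
      Finset.sum_nonneg fun i _ => mul_nonneg (by positivity) (Finset.sum_nonneg fun i _ => cst_nonneg _ _ _)
    positivity
  rw [Finset.sum_congr rfl (fun x _ => this x), ← Finset.mul_sum, Finset.sum_add_distrib, mul_assoc]
  apply mul_le_mul_of_nonneg_left _ (by positivity)
  rw [add_mul]
  apply add_le_add (doob N g H)
  rw [Finset.sum_comm]
  have hS : 0 ≤ ∑ x, ‖g N x‖^2 := Finset.sum_nonneg fun _ _ => by positivity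
  calc _ ≤ ∑ m ∈ Finset.range L, ((1/2:ℝ)^(r-2))^(m+1) * ∑ x, ‖g N x‖^2 := by
        apply Finset.sum_le_sum
        intro m _
        rw [← Finset.mul_sum]
        apply mul_le_mul_of_nonneg_left _ (by positivity)
        have := cost_bound N g H ((1/2)^(m+1)) N le_rfl
        have h0 : 0 ≤ ∑ x, ‖g N x - anch ((1/2)^(m+1)) (fun j => g j x) N‖^2 := Finset.sum_nonneg fun _ _ => by positivity
        linarith
    _ ≤ _ := by
        rw [← Finset.sum_mul]
        exact mul_le_mul_of_nonneg_right (geom_sum_succ_le _ hw hw1 L) hS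
end mart

open Polynomial in
/-- generating polynomial of the Krawtchouk numbers -/
noncomputable def kp (n m : ℕ) : Polynomial ℝ := (1 - X)^m * (1 + X)^(n-m)

/-- normalized Krawtchouk numbers -/
noncomputable def kr (n m k : ℕ) : ℝ := (kp n m).coeff k / (n.choose k : ℝ)

/-- real valued character -/
noncomputable def chiR {n : ℕ} (y x : Fin n → Bool) : ℝ :=
  ∏ j, if x j = true ∧ y j = true then (-1:ℝ) else 1

lemma chi_eq {n : ℕ} (y x : Fin n → Bool) : chi y x = (chiR y x : ℂ) := by
  unfold chi chiR
  rw [Finset.prod_ite]; simp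

lemma chiR_comm {n : ℕ} (y x : Fin n → Bool) : chiR y x = chiR x y := by
  unfold chiR; simp only [and_comm]

lemma kp_eq {n : ℕ} (y : Fin n → Bool) :
    kp n (wt y) = ∑ x : Fin n → Bool, Polynomial.C (chiR y x) * Polynomial.X ^ (wt x) := by
  have h1 : kp n (wt y) = ∏ j : Fin n, ∑ b : Bool, (if b = true then (if y j = true then -Polynomial.X else Polynomial.X) else (1 : Polynomial ℝ)) := by
    have : ∀ j, ∑ b : Bool, (if b = true then (if y j = true then -Polynomial.X else Polynomial.X) else (1 : Polynomial ℝ)) = if y j = true then 1 - Polynomial.X else 1 + Polynomial.X := by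
      intro j; cases y j <;> simp <;> ring
    simp only [this]
    rw [Finset.prod_ite, Finset.prod_const, Finset.prod_const, kp, wt]
    congr 2
    have := Finset.card_filter_add_card_filter_not (s := (Finset.univ : Finset (Fin n))) (fun j => y j = true)
    simp at this ⊢
    omega
  rw [h1, Finset.prod_univ_sum, Fintype.piFinset_univ]
  apply Finset.sum_congr rfl
  intro x _
  unfold chiR wt
  rw [map_prod, ← Finset.prod_const, Finset.prod_filter, ← Finset.prod_mul_distrib]
  apply Finset.prod_congr rfl
  intro j _
  cases x j <;> cases y j <;> simp

lemma coeff_kp {n : ℕ} (y : Fin n → Bool) (k : ℕ) :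
    (kp n (wt y)).coeff k = ∑ x : Fin n → Bool with wt x = k, chiR y x := by
  rw [kp_eq, Polynomial.finsetSum_coeff, Finset.sum_filter]
  apply Finset.sum_congr rfl
  intro x _
  rw [Polynomial.coeff_C_mul, Polynomial.coeff_X_pow]
  simp [eq_comm]

lemma card_wt (n k : ℕ) : (((Finset.univ : Finset (Fin n → Bool)).filter (fun x => wt x = k)).card : ℝ) = n.choose k := by
  have h := coeff_kp (fun _ : Fin n => false) k
  have h0 : wt (fun _ : Fin n => false) = 0 := by simp [wt]
  rw [h0] at h
  simp [kp, chiR, Polynomial.coeff_one_add_X_pow] at h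
  exact_mod_cast h.symm

lemma kr_symm (n m k : ℕ) (hm : m ≤ n) (hk : k ≤ n) : kr n m k = kr n k m := by
  have h1 : ∀ m k : ℕ, ∑ y : Fin n → Bool with wt y = m, ∑ x : Fin n → Bool with wt x = k, chiR y x = n.choose m * (kp n m).coeff k := by
    intro m k
    rw [← card_wt, ← nsmul_eq_mul, ← Finset.sum_const]
    apply Finset.sum_congr rfl
    intro y hy
    rw [← coeff_kp, (Finset.mem_filter.1 hy).2]
  have h5 : (n.choose m : ℝ) * (kp n m).coeff k = n.choose k * (kp n k).coeff m := by
    rw [← h1, ← h1, Finset.sum_comm]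
    exact Finset.sum_congr rfl fun y _ => Finset.sum_congr rfl fun x _ => chiR_comm _ _
  have c1 : (n.choose m : ℝ) ≠ 0 := by exact_mod_cast (Nat.choose_pos hm).ne'
  have c2 : (n.choose k : ℝ) ≠ 0 := by exact_mod_cast (Nat.choose_pos hk).ne'
  unfold kr
  field_simp
  linarith

lemma kp_rec (n m : ℕ) (hm : m ≤ n) (k : ℕ) :
    ((k:ℝ)+2) * (kp n m).coeff (k+2) + ((n:ℝ)-k) * (kp n m).coeff k = ((n:ℝ)-2*m) * (kp n m).coeff (k+1) := by
  have hd : (1 - Polynomial.X * Polynomial.X) * Polynomial.derivative (kp n m) =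
      Polynomial.C ((n:ℝ)-2*m) * kp n m - Polynomial.C (n:ℝ) * (Polynomial.X * kp n m) := by
    have e1 : ∀ j : ℕ, (1 - Polynomial.X) * Polynomial.derivative ((1 - Polynomial.X : Polynomial ℝ)^j) = - (j : Polynomial ℝ) * (1 - Polynomial.X)^j := by
      intro j
      cases j with
      | zero => simp
      | succ j => rw [Polynomial.derivative_pow_succ]; simp; ring
    have e2 : ∀ j : ℕ, (1 + Polynomial.X) * Polynomial.derivative ((1 + Polynomial.X : Polynomial ℝ)^j) = (j : Polynomial ℝ) * (1 + Polynomial.X)^j := by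
      intro j
      cases j with
      | zero => simp
      | succ j => rw [Polynomial.derivative_pow_succ]; simp; ring
    have hc : ((n - m : ℕ) : Polynomial ℝ) = n - m := by rw [Nat.cast_sub hm]
    rw [kp, Polynomial.derivative_mul]
    have a1 := e1 m
    have a2 := e2 (n-m)
    rw [hc] at a2
    simp only [map_sub, map_mul, map_natCast]
    have : Polynomial.C (2:ℝ) = 2 := rfl
    rw [this]
    linear_combination (1 + Polynomial.X) * (1 + Polynomial.X)^(n-m) * a1 + (1 - Polynomial.X) * (1 - Polynomial.X)^m * a2
  have h := congrArg (fun p => Polynomial.coeff p (k+1)) hd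
  simp only [sub_mul, one_mul, mul_assoc, Polynomial.coeff_sub, Polynomial.coeff_C_mul, Polynomial.coeff_X_mul, Polynomial.coeff_derivative] at h
  have h2 : (Polynomial.X * Polynomial.derivative (kp n m)).coeff k = k * (kp n m).coeff k := by
    cases k with
    | zero => simp
    | succ k => rw [Polynomial.coeff_X_mul, Polynomial.coeff_derivative]; push_cast; ring
  rw [h2] at h
  push_cast at h
  linear_combination h

lemma kr_zero (n m : ℕ) : kr n m 0 = 1 := by
  simp [kr, kp, Polynomial.coeff_zero_eq_eval_zero]

lemma kr_one (n m : ℕ) (hm : m ≤ n) (hn : 0 < n) : kr n m 1 = 1 - 2 * m / n := by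
  have h1 : kr n m 1 = kr n 1 m := kr_symm n m 1 hm hn
  have h : (kp n m).coeff 1 = n - 2 * m := by
    have e : kp n m = (1 - Polynomial.X)^m * (1 + Polynomial.X)^(n-m) := rfl
    have d : (kp n m).coeff 1 = (Polynomial.derivative (kp n m)).eval 0 := by
      rw [← Polynomial.coeff_zero_eq_eval_zero, Polynomial.coeff_derivative]; simp
    rw [d, e]
    simp [Polynomial.derivative_mul, Polynomial.derivative_pow, Nat.cast_sub hm]; ring
  rw [kr, h, Nat.choose_one_right]
  have : (n:ℝ) ≠ 0 := by exact_mod_cast hn.ne'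
  field_simp

lemma kr_rec (n m : ℕ) (hm : m ≤ n) (k : ℕ) (hk : k + 2 ≤ n) :
    ((n:ℝ)-(k+1)) * kr n m (k+2) + (k+1) * kr n m k = (n-2*m) * kr n m (k+1) := by
  have h := kp_rec n m hm k
  have c0 : (n.choose k : ℝ) ≠ 0 := by exact_mod_cast (Nat.choose_pos (by omega : k ≤ n)).ne'
  have c1 : (n.choose (k+1) : ℝ) ≠ 0 := by exact_mod_cast (Nat.choose_pos (by omega : k+1 ≤ n)).ne'
  have c2 : (n.choose (k+2) : ℝ) ≠ 0 := by exact_mod_cast (Nat.choose_pos (by omega : k+2 ≤ n)).ne'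
  have e0 : (kp n m).coeff k = kr n m k * n.choose k := by unfold kr; field_simp
  have e1 : (kp n m).coeff (k+1) = kr n m (k+1) * n.choose (k+1) := by unfold kr; field_simp
  have e2 : (kp n m).coeff (k+2) = kr n m (k+2) * n.choose (k+2) := by unfold kr; field_simp
  rw [e0, e1, e2] at h
  have r1 : (n.choose (k+1) : ℝ) * (k+1) = n.choose k * ((n:ℝ)-k) := by
    have := Nat.choose_succ_right_eq n k
    have := congrArg (Nat.cast : ℕ → ℝ) this
    push_cast [Nat.cast_sub (by omega : k ≤ n)] at this
    exact this
  have r2 : (n.choose (k+2) : ℝ) * (k+2) = n.choose (k+1) * ((n:ℝ)-(k+1)) := by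
    have := Nat.choose_succ_right_eq n (k+1)
    have := congrArg (Nat.cast : ℕ → ℝ) this
    push_cast [Nat.cast_sub (by omega : k+1 ≤ n)] at this
    linear_combination this
  apply mul_left_cancel₀ c1
  linear_combination h - kr n m (k+2) * r2 + kr n m k * r1

lemma kr_diff (N m k : ℕ) (hk : k ≤ N) (hm : m ≤ N) :
    kr (N+1) k (m+1) - kr (N+1) (k+1) (m+1) = 2 * (m+1) / (N+1) * kr N k m := by
  have e : kp (N+1) k - kp (N+1) (k+1) = Polynomial.C (2:ℝ) * (Polynomial.X * kp N k) := by
    have h1 : N + 1 - k = (N - k) + 1 := by omega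
    have h2 : N + 1 - (k+1) = N - k := by omega
    have : Polynomial.C (2:ℝ) = 2 := rfl
    rw [kp, kp, kp, h1, h2, this]; ring
  have h := congrArg (fun p => Polynomial.coeff p (m+1)) e
  simp only [Polynomial.coeff_sub, Polynomial.coeff_C_mul, Polynomial.coeff_X_mul] at h
  have c : ((N+1).choose (m+1) : ℝ) * (m+1) = (N+1) * N.choose m := by
    have := congrArg (Nat.cast : ℕ → ℝ) (Nat.add_one_mul_choose_eq N m)
    push_cast at this
    linarith
  have c0 : (N.choose m : ℝ) ≠ 0 := by exact_mod_cast (Nat.choose_pos hm).ne'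
  have c1 : ((N+1).choose (m+1) : ℝ) ≠ 0 := by exact_mod_cast (Nat.choose_pos (by omega : m+1 ≤ N+1)).ne'
  have c2 : ((N:ℝ)+1) ≠ 0 := by positivity
  unfold kr
  rw [← sub_div, h]
  field_simp
  linear_combination -(kp N k).coeff m * c

lemma kr_bd1 (n m : ℕ) (hn : 0 < n) (hm : 2 * m ≤ n) : ∀ k ≤ m, |kr n m k| ≤ (1 - (m:ℝ)/(2*n))^(min k (m/2)) := by
  have hn' : (0:ℝ) < n := by exact_mod_cast hn
  have hm' : 2 * (m:ℝ) ≤ n := by exact_mod_cast hm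
  have hm0 : (0:ℝ) ≤ m := by positivity
  set δ : ℝ := (m:ℝ)/(2*n) with hδ
  have d0 : 0 ≤ δ := by positivity
  have d1 : δ ≤ 1/4 := by rw [hδ, div_le_iff₀ (by positivity)]; linarith
  have dn : n * δ = m / 2 := by rw [hδ]; field_simp
  set θ := 1 - δ with hθ
  have t0 : 0 < θ := by linarith
  have t1 : θ ≤ 1 := by linarith
  have main : ∀ k, (k ≤ m → |kr n m k| ≤ θ^(min k (m/2))) ∧ (k + 1 ≤ m → |kr n m (k+1)| ≤ θ^(min (k+1) (m/2))) := by
    intro k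
    induction k with
    | zero =>
      refine ⟨fun _ => by simp [kr_zero], fun hk => ?_⟩
      rw [kr_one n m (by omega) hn]
      have a1 : 1 - 2 * (m:ℝ) / n = 1 - 4 * δ := by rw [hδ]; field_simp; ring
      rw [a1, abs_of_nonneg (by linarith)]
      calc 1 - 4 * δ ≤ θ := by linarith
        _ = θ^1 := (pow_one _).symm
        _ ≤ _ := pow_le_pow_of_le_one t0.le t1 (by simp)
    | succ k ih =>
      refine ⟨ih.2, fun hk => ?_⟩
      have i1 := ih.1 (by omega)
      have i2 := ih.2 (by omega)
      have hk' : (k:ℝ) + 2 ≤ m := by exact_mod_cast hk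
      have hrec := kr_rec n m (by omega) k (by omega)
      have hpos : (0:ℝ) < n - (k+1) := by linarith
      have h1 : ((n:ℝ)-(k+1)) * |kr n m (k+2)| ≤ (n-2*m) * |kr n m (k+1)| + (k+1) * |kr n m k| := by
        have e : ((n:ℝ)-(k+1)) * kr n m (k+2) = (n-2*m) * kr n m (k+1) - (k+1) * kr n m k := by linarith
        calc _ = |((n:ℝ)-(k+1)) * kr n m (k+2)| := by rw [abs_mul, abs_of_pos hpos]
          _ ≤ _ := by
            rw [e]
            refine (abs_sub _ _).trans ?_
            rw [abs_mul, abs_mul, abs_of_nonneg (by linarith : (0:ℝ) ≤ n - 2*m), abs_of_nonneg (by positivity : (0:ℝ) ≤ k+1)]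
      have h2 : (n-2*m) * |kr n m (k+1)| + (k+1) * |kr n m k| ≤ (n-2*m) * θ^(min (k+1) (m/2)) + (k+1) * θ^(min k (m/2)) := by
        have : (0:ℝ) ≤ n - 2*m := by linarith
        gcongr
      have h3 : (n-2*m) * θ^(min (k+1) (m/2)) + (k+1) * θ^(min k (m/2)) ≤ ((n:ℝ)-(k+1)) * θ^(min (k+2) (m/2)) := by
        have quad : k + 1 ≤ m/2 → (n-2*m) * θ + (k+1) ≤ ((n:ℝ)-(k+1)) * θ^2 := by
          intro hk2
          have : 2 * (k+1) ≤ m := by omega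
          have : 2 * ((k:ℝ)+1) ≤ m := by exact_mod_cast this
          have hx : (0:ℝ) ≤ (n - (k+1)) * δ^2 := by positivity
          have hy : 0 ≤ (m/2 - ((k:ℝ)+1)) * (1 - δ) := mul_nonneg (by linarith) (by linarith)
          have hz : 0 ≤ m * (1/4 - δ) := mul_nonneg hm0 (by linarith)
          rw [hθ]
          nlinarith
        rcases lt_or_ge (k+1) (m/2) with hc | hc
        · rw [min_eq_left (by omega), min_eq_left (by omega), min_eq_left (by omega)]
          have q := quad hc.le
          have := mul_le_mul_of_nonneg_left q (pow_nonneg t0.le k)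
          rw [pow_succ, show k + 2 = k + 2 from rfl, pow_add]
          linarith
        · rcases lt_or_ge k (m/2) with hc2 | hc2
          · have hkk : m/2 = k+1 := by omega
            rw [hkk, min_eq_left (by omega), min_eq_left (by omega), min_eq_right (by omega), pow_succ]
            have q := quad (by omega)
            have q2 : (n-2*m) * θ + (k+1) ≤ ((n:ℝ)-(k+1)) * θ := by
              refine q.trans (mul_le_mul_of_nonneg_left ?_ hpos.le)
              nlinarith
            have := mul_le_mul_of_nonneg_left q2 (pow_nonneg t0.le k)
            linarith
          · rw [min_eq_right (by omega), min_eq_right (by omega), min_eq_right (by omega), ← add_mul]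
            apply mul_le_mul_of_nonneg_right _ (by positivity)
            linarith
      exact le_of_mul_le_mul_left (h1.trans (h2.trans h3)) hpos
  exact fun k hk => (main k).1 hk

lemma kr_bd2 (n m k : ℕ) (hn : 0 < n) (hm : 2 * m ≤ n) (hk : k ≤ m) : |kr n m k| ≤ 2 * Real.exp (-(k*m/(4*n))) := by
  have hn' : (0:ℝ) < n := by exact_mod_cast hn
  have hm' : 2 * (m:ℝ) ≤ n := by exact_mod_cast hm
  refine (kr_bd1 n m hn hm k hk).trans ?_
  have h1 : 1 - (m:ℝ)/(2*n) ≤ Real.exp (-((m:ℝ)/(2*n))) := by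
    have := Real.add_one_le_exp (-((m:ℝ)/(2*n))); linarith
  have h0 : 0 ≤ 1 - (m:ℝ)/(2*n) := by
    rw [sub_nonneg, div_le_iff₀ (by positivity)]; linarith [(Nat.cast_nonneg m : (0:ℝ) ≤ m)]
  have hmin : (k:ℝ) - 1 ≤ 2 * (min k (m/2) : ℕ) := by
    have : k ≤ 2 * min k (m/2) + 1 := by omega
    have : (k:ℝ) ≤ 2 * (min k (m/2) : ℕ) + 1 := by exact_mod_cast this
    linarith
  calc _ ≤ (Real.exp (-((m:ℝ)/(2*n))))^(min k (m/2)) := pow_le_pow_left₀ h0 h1 _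
    _ = Real.exp (-((min k (m/2) : ℕ) * ((m:ℝ)/(2*n)))) := by rw [← Real.exp_nat_mul]; congr 1; ring
    _ ≤ Real.exp (1/8 + (-(k*m/(4*n)))) := by
      apply Real.exp_le_exp.2
      have : ((k:ℝ) - 1) * (m/(4*n)) ≤ 2 * (min k (m/2) : ℕ) * (m/(4*n)) := mul_le_mul_of_nonneg_right hmin (by positivity)
      have h3 : (m:ℝ)/(4*n) ≤ 1/8 := by rw [div_le_iff₀ (by positivity)]; linarith
      have e1 : (m:ℝ)/(2*n) = 2 * (m/(4*n)) := by field_simp; ring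
      have e2 : (k:ℝ)*m/(4*n) = k * (m/(4*n)) := by ring
      rw [e1, e2]; linarith
    _ ≤ _ := by
      rw [Real.exp_add]
      apply mul_le_mul_of_nonneg_right _ (Real.exp_pos _).le
      have := Real.exp_bound_div_one_sub_of_interval (x := 1/8) (by norm_num) (by norm_num)
      refine this.trans (by norm_num)

lemma kr_bd (n m k : ℕ) (hm : 2 * m ≤ n) (hk : 2 * k ≤ n) : |kr n m k| ≤ 2 * Real.exp (-(k*m/(4*n))) := by
  rcases Nat.eq_zero_or_pos n with h | hn
  · have : k = 0 := by omega
    subst this; rw [kr_zero]; simp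
  rcases le_total k m with h | h
  · exact kr_bd2 n m k hn hm h
  · rw [kr_symm n m k (by omega) (by omega), mul_comm (k:ℝ)]
    exact kr_bd2 n k m hn hk h

lemma kr_step (n m k : ℕ) (hm : 2 * m ≤ n) (hk : 2 * (k+1) ≤ n) :
    |kr n m (k+1) - kr n m k| ≤ 8 * ((m:ℝ)/n) * Real.exp (-(k*m/(8*n))) := by
  rw [kr_symm n m (k+1) (by omega) (by omega), kr_symm n m k (by omega) (by omega), abs_sub_comm]
  rcases m with _ | m
  · simp [kr_zero]
  obtain ⟨N, rfl⟩ : ∃ N, n = N + 1 := ⟨n-1, by omega⟩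
  rw [kr_diff N m k (by omega) (by omega), kr_symm N k m (by omega) (by omega), abs_mul, abs_of_nonneg (by positivity)]
  have hb := kr_bd N m k (by omega) (by omega)
  have hN : 0 < N := by omega
  have hN' : (0:ℝ) < N := by exact_mod_cast hN
  have hkN : 2 * (k:ℝ) ≤ N := by exact_mod_cast (by omega : 2 * k ≤ N)
  have : 2 * Real.exp (-((k:ℝ)*m/(4*N))) ≤ 4 * Real.exp (-((k:ℝ)*((m+1:ℕ):ℝ)/(8*((N+1:ℕ):ℝ)))) := by
    have h1 : Real.exp (-((k:ℝ)*m/(4*N))) ≤ Real.exp (1/8 + -((k:ℝ)*((m+1:ℕ):ℝ)/(8*((N+1:ℕ):ℝ)))) := by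
      apply Real.exp_le_exp.2
      have : (k:ℝ)*((m+1:ℕ):ℝ)/(8*((N+1:ℕ):ℝ)) ≤ 1/8 + (k:ℝ)*m/(4*N) := by
        have h2 : (k:ℝ)*((m+1:ℕ):ℝ)/(8*((N+1:ℕ):ℝ)) ≤ (k:ℝ)*(m+1)/(8*N) := by
          push_cast
          apply div_le_div_of_nonneg_left <;> first | positivity | linarith
        refine h2.trans ?_
        rw [← sub_nonneg]
        have : 1/8 + (k:ℝ)*m/(4*N) - (k:ℝ)*(m+1)/(8*N) = ((N - k) + k * m)/(8*N) := by field_simp; ring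
        rw [this]
        have : 0 ≤ (N:ℝ) - k := by linarith [(Nat.cast_nonneg k : (0:ℝ) ≤ k)]
        positivity
      linarith
    rw [Real.exp_add] at h1
    have := Real.exp_bound_div_one_sub_of_interval (x := 1/8) (by norm_num) (by norm_num)
    have h8 : Real.exp (1/8) ≤ 2 := this.trans (by norm_num)
    have := mul_le_mul_of_nonneg_right h8 (Real.exp_pos (-((k:ℝ)*((m+1:ℕ):ℝ)/(8*((N+1:ℕ):ℝ))))).le
    linarith
  calc _ ≤ 2 * ((m:ℝ)+1) / (N+1) * (4 * Real.exp (-((k:ℝ)*((m+1:ℕ):ℝ)/(8*((N+1:ℕ):ℝ))))) :=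
        mul_le_mul_of_nonneg_left (hb.trans this) (by positivity)
    _ = _ := by push_cast; ring

lemma VarLE.add {r : ℝ} (hr : 1 ≤ r) {N : ℕ} {a b : ℕ → ℂ} {A B : ℝ} (hA : 0 ≤ A) (hB : 0 ≤ B)
    (ha : VarLE r N a A) (hb : VarLE r N b B) : VarLE r N (fun k => a k + b k) (A + B) := by
  intro J t ht htN
  have hr0 : 0 < r := by linarith
  have h1 := ha J t ht htN
  have h2 := hb J t ht htN
  have e1 := Real.rpow_le_rpow (Finset.sum_nonneg fun _ _ => by positivity) h1 (by positivity : 0 ≤ 1/r)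
  have e2 := Real.rpow_le_rpow (Finset.sum_nonneg fun _ _ => by positivity) h2 (by positivity : 0 ≤ 1/r)
  rw [← Real.rpow_mul hA, mul_one_div_cancel hr0.ne', Real.rpow_one] at e1
  rw [← Real.rpow_mul hB, mul_one_div_cancel hr0.ne', Real.rpow_one] at e2
  have h3 := Real.Lp_add_le_of_nonneg (Finset.range J) (p := r) hr
    (f := fun j => ‖a (t (j+1)) - a (t j)‖) (g := fun j => ‖b (t (j+1)) - b (t j)‖)
    (fun _ _ => norm_nonneg _) (fun _ _ => norm_nonneg _)
  have h4 := h3.trans (add_le_add e1 e2)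
  have h5 := Real.rpow_le_rpow (Real.rpow_nonneg (Finset.sum_nonneg fun _ _ => by positivity) _) h4 hr0.le
  rw [← Real.rpow_mul (Finset.sum_nonneg fun _ _ => by positivity), one_div_mul_cancel hr0.ne', Real.rpow_one] at h5
  refine le_trans (Finset.sum_le_sum fun j _ => ?_) h5
  apply Real.rpow_le_rpow (norm_nonneg _) _ hr0.le
  refine le_trans (le_of_eq ?_) (norm_add_le _ _)
  congr 1; ring

lemma VarLE.smul {r : ℝ} (hr : 1 ≤ r) {N : ℕ} {a : ℕ → ℂ} {A : ℝ} (hA : 0 ≤ A)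
    (ha : VarLE r N a A) (c : ℝ) (hc : 0 ≤ c) : VarLE r N (fun k => (c:ℂ) * a k) (c * A) := by
  intro J t ht htN
  rw [Real.mul_rpow hc hA]
  refine le_trans (le_of_eq ?_) (mul_le_mul_of_nonneg_left (ha J t ht htN) (Real.rpow_nonneg hc r))
  rw [Finset.mul_sum]
  apply Finset.sum_congr rfl
  intro j _
  rw [← mul_sub, norm_mul, Complex.norm_of_nonneg hc, Real.mul_rpow hc (norm_nonneg _)]

lemma VarLE.sum {ι : Type*} {r : ℝ} (hr : 1 ≤ r) {N : ℕ} (s : Finset ι) (a : ι → ℕ → ℂ) (A : ι → ℝ) (hA : ∀ i, 0 ≤ A i)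
    (ha : ∀ i, VarLE r N (a i) (A i)) : VarLE r N (fun k => ∑ i ∈ s, a i k) (∑ i ∈ s, A i) := by
  classical
  induction s using Finset.induction_on with
  | empty =>
    intro J t ht htN
    simp [Real.zero_rpow (by linarith : r ≠ 0)]
  | insert i s hi ih =>
    have := VarLE.add hr (hA i) (Finset.sum_nonneg fun j _ => hA j) (ha i) ih
    simpa only [Finset.sum_insert hi] using this

lemma VarLE.clamp {r : ℝ} {N : ℕ} {a : ℕ → ℂ} {A : ℝ} (ha : VarLE r N a A) (n : ℕ) :
    VarLE r n (fun k => a (min k N)) A := by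
  intro J t ht htN
  exact ha J (fun j => min (t j) N) (fun i j h => min_le_min_right N (ht h)) (fun j => min_le_right _ _)

lemma VarLE.rev {r : ℝ} {N : ℕ} {a : ℕ → ℂ} {A : ℝ} (ha : VarLE r N a A) (n : ℕ) :
    VarLE r n (fun k => a (min (n - k) N)) A := by
  intro J t ht htN
  have h := ha J (fun j => min (n - t (J - j)) N) (fun i j h => by
    apply min_le_min_right
    exact Nat.sub_le_sub_left (ht (by omega)) n) (fun j => min_le_right _ _)
  refine le_trans (le_of_eq ?_) h
  rw [← Finset.sum_range_reflect]
  apply Finset.sum_congr rfl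
  intro j hj
  have hj := Finset.mem_range.1 hj
  have e1 : J - 1 - j + 1 = J - j := by omega
  have e2 : J - (j+1) = J - 1 - j := by omega
  simp only [e1, e2]
  rw [norm_sub_rev]

lemma VarLE.of_sq {r : ℝ} (hr : 2 < r) {N : ℕ} {a : ℕ → ℂ} {U : ℝ}
    (h : ∀ (J : ℕ) (t : ℕ → ℕ), Monotone t → (∀ j, t j ≤ N) →
      ∑ j ∈ Finset.range J, ‖a (t (j+1)) - a (t j)‖ ^ 2 ≤ U) : VarLE r N a (Real.sqrt U) := by
  have hU : 0 ≤ U := by simpa using h 0 (fun _ => 0) monotone_const (fun _ => Nat.zero_le _)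
  intro J t ht htN
  have h1 := h J t ht htN
  have key : ∀ j ∈ Finset.range J, ‖a (t (j+1)) - a (t j)‖ ^ r ≤ (Real.sqrt U)^(r-2) * ‖a (t (j+1)) - a (t j)‖ ^ 2 := by
    intro j hj
    have h2 : ‖a (t (j+1)) - a (t j)‖ ^ 2 ≤ U :=
      (Finset.single_le_sum (f := fun j => ‖a (t (j+1)) - a (t j)‖ ^ 2) (fun _ _ => by positivity) hj).trans h1
    have h3 := Real.le_sqrt_of_sq_le h2
    have e : ‖a (t (j+1)) - a (t j)‖ ^ r = ‖a (t (j+1)) - a (t j)‖ ^ (r-2) * ‖a (t (j+1)) - a (t j)‖ ^ 2 := by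
      rw [← Real.rpow_natCast, ← Real.rpow_add_of_nonneg (norm_nonneg _) (by linarith) (by norm_num)]
      norm_num
    rw [e]
    exact mul_le_mul_of_nonneg_right (Real.rpow_le_rpow (norm_nonneg _) h3 (by linarith)) (by positivity)
  refine (Finset.sum_le_sum key).trans ?_
  rw [← Finset.mul_sum]
  refine (mul_le_mul_of_nonneg_left h1 (by positivity)).trans (le_of_eq ?_)
  nth_rewrite 2 [← Real.sq_sqrt hU]
  rw [← Real.rpow_natCast, ← Real.rpow_add_of_nonneg (Real.sqrt_nonneg _) (by linarith) (by norm_num)]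
  norm_num

lemma sq_le_diff (z w : ℂ) : ‖z - w‖^2 ≤ 2 * ‖(‖z‖:ℂ) * z - (‖w‖:ℂ) * w‖ := by
  have h1 : (starRingEnd ℂ (z - w) * ((‖z‖:ℂ) * z - (‖w‖:ℂ) * w)).re ≤ ‖z - w‖ * ‖(‖z‖:ℂ) * z - (‖w‖:ℂ) * w‖ := by
    refine (Complex.re_le_norm _).trans ?_
    rw [norm_mul, Complex.norm_conj]
  have e : (starRingEnd ℂ (z - w) * ((‖z‖:ℂ) * z - (‖w‖:ℂ) * w)).re = (‖z‖+‖w‖)/2 * ‖z-w‖^2 + (‖z‖-‖w‖)/2 * (‖z‖^2-‖w‖^2) := by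
    rw [← Complex.normSq_eq_norm_sq, ← Complex.normSq_eq_norm_sq, ← Complex.normSq_eq_norm_sq]
    simp only [Complex.normSq_apply, Complex.mul_re, Complex.conj_re, Complex.conj_im, Complex.sub_re, Complex.sub_im, Complex.ofReal_re, Complex.ofReal_im, Complex.mul_im]
    ring
  rw [e] at h1
  have h2 : 0 ≤ (‖z‖-‖w‖)/2 * (‖z‖^2-‖w‖^2) := by
    have : (‖z‖-‖w‖)/2 * (‖z‖^2-‖w‖^2) = (‖z‖-‖w‖)^2/2 * (‖z‖+‖w‖) := by ring
    rw [this]; positivity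
  have h3 : ‖z - w‖ ≤ ‖z‖ + ‖w‖ := norm_sub_le z w
  by_cases hz : ‖z - w‖ = 0
  · rw [hz]; simp
  have hp : 0 < ‖z - w‖ := lt_of_le_of_ne (norm_nonneg _) (Ne.symm hz)
  have h4 : ‖z-w‖ * (‖z-w‖^2/2) ≤ ‖z - w‖ * ‖(‖z‖:ℂ) * z - (‖w‖:ℂ) * w‖ := by
    have := mul_le_mul_of_nonneg_right h3 (by positivity : 0 ≤ ‖z-w‖^2/2)
    linarith
  have := le_of_mul_le_mul_left h4 hp
  linarith

lemma diff_le (z w : ℂ) : ‖(‖z‖:ℂ) * z - (‖w‖:ℂ) * w‖ ≤ ‖z - w‖ * (‖z‖ + ‖w‖) := by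
  have e : (‖z‖:ℂ) * z - (‖w‖:ℂ) * w = (‖z‖:ℂ) * (z - w) + ((‖z‖ - ‖w‖ : ℝ) : ℂ) * w := by push_cast; ring
  rw [e]
  refine (norm_add_le _ _).trans ?_
  rw [norm_mul, norm_mul, Complex.norm_real, Complex.norm_real, norm_norm, Real.norm_eq_abs]
  have := mul_le_mul_of_nonneg_right (abs_norm_sub_norm_le z w) (norm_nonneg w)
  linarith

lemma VarLE.of_steps {r : ℝ} (hr : 2 < r) (N : ℕ) (a : ℕ → ℂ) : VarLE r N a
    (Real.sqrt (∑ k ∈ Finset.range N, 2 * ((k+1) * ‖a (k+1) - a k‖^2 + (‖a k‖^2 + ‖a (k+1)‖^2)/(2*(k+1))))) := by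
  apply VarLE.of_sq hr
  intro J t ht htN
  set c : ℕ → ℝ := fun k => 2 * ((k+1) * ‖a (k+1) - a k‖^2 + (‖a k‖^2 + ‖a (k+1)‖^2)/(2*(k+1))) with hc
  have c0 : ∀ k, 0 ≤ c k := fun k => by simp only [hc]; positivity
  have hstep : ∀ k, 2 * ‖(‖a (k+1)‖:ℂ) * a (k+1) - (‖a k‖:ℂ) * a k‖ ≤ c k := by
    intro k
    have h1 := diff_le (a (k+1)) (a k)
    have am : ∀ u v w : ℝ, 0 < w → u * v ≤ w/2 * u^2 + v^2/(2*w) := by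
      intro u v w hw
      rw [← sub_nonneg]
      have : w/2 * u^2 + v^2/(2*w) - u*v = (w*u - v)^2/(2*w) := by field_simp; ring
      rw [this]; positivity
    have k0 : (0:ℝ) < k+1 := by positivity
    have h2 := am ‖a (k+1) - a k‖ ‖a (k+1)‖ (k+1) k0
    have h3 := am ‖a (k+1) - a k‖ ‖a k‖ (k+1) k0
    simp only [hc]
    rw [add_div]
    linarith
  have hpair : ∀ s u, s ≤ u → ‖a u - a s‖^2 ≤ ∑ k ∈ Finset.Ico s u, c k := by
    intro s u hsu
    refine (sq_le_diff _ _).trans ?_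
    have := Finset.sum_Ico_sub (fun k => (‖a k‖:ℂ) * a k) hsu
    rw [← this]
    refine (mul_le_mul_of_nonneg_left (norm_sum_le _ _) (by norm_num)).trans ?_
    rw [Finset.mul_sum]
    exact Finset.sum_le_sum fun k _ => hstep k
  refine (Finset.sum_le_sum fun j _ => hpair _ _ (ht (Nat.le_succ j))).trans ?_
  rw [sum_Ico_mono _ _ ht]
  apply Finset.sum_le_sum_of_subset_of_nonneg
  · intro i hi
    rw [Finset.mem_Ico] at hi
    exact Finset.mem_range.2 (hi.2.trans_le (htN _))
  · intro i _ _; exact c0 i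

lemma VarLE.jump {r : ℝ} (hr : 2 < r) (n h : ℕ) (u v : ℂ) :
    VarLE r n (fun k => if k ≤ h then u else v) ‖u - v‖ := by
  have key : ∀ (J : ℕ) (t : ℕ → ℕ), Monotone t → ∑ j ∈ Finset.range J,
      ‖(if t (j+1) ≤ h then u else v) - (if t j ≤ h then u else v)‖ ^ r =
      if t 0 ≤ h ∧ ¬ t J ≤ h then ‖u - v‖^r else 0 := by
    intro J t ht
    induction J with
    | zero => simp
    | succ J ih =>
      rw [Finset.sum_range_succ, ih]
      have h1 : t 0 ≤ t J := ht (Nat.zero_le _)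
      have h2 : t J ≤ t (J+1) := ht (Nat.le_succ _)
      have z : (0:ℝ)^r = 0 := Real.zero_rpow (by linarith)
      by_cases a : t J ≤ h
      · by_cases b : t (J+1) ≤ h
        · simp [a, b, z]
        · simp [a, b, h1.trans a, norm_sub_rev]
      · have b : ¬ t (J+1) ≤ h := by omega
        simp [a, b, z]
  intro J t ht htN
  rw [key J t ht]
  split_ifs
  · exact le_rfl
  · positivity

lemma mult_sum (D : ℕ → ℝ) (h : ℕ) (q A : ℝ) (hq : 0 ≤ q) (hq1 : q ≤ 1) (hA : 0 ≤ A) (D0 : D 0 = 0)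
    (hstep : ∀ k < h, |D (k+1) - D k| ≤ A * q * Real.exp (-(k*q/8)))
    (hD : ∀ k ≤ h, |D k| ≤ A * Real.exp (-(k*q/8))) :
    ∑ k ∈ Finset.range h, ((k+1) * (D (k+1) - D k)^2 + ((D k)^2 + (D (k+1))^2)/(2*(k+1))) ≤ 90 * A^2 := by
  have hlin : ∀ k ≤ h, |D k| ≤ A * q * k := by
    intro k hk
    induction k with
    | zero => simp [D0]
    | succ k ih =>
      have h1 := ih (by omega)
      have h2 := hstep k (by omega)
      have h3 : Real.exp (-(k*q/8)) ≤ 1 := Real.exp_le_one_iff.2 (by have : 0 ≤ (k:ℝ)*q/8 := by positivity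
                                                                     linarith)
      have h4 := mul_le_mul_of_nonneg_left h3 (by positivity : 0 ≤ A * q)
      have h5 : |D (k+1)| ≤ |D (k+1) - D k| + |D k| := by
        have := abs_add_le (D (k+1) - D k) (D k); simpa using this
      push_cast
      linarith
  have hsq : ∀ k ≤ h, (D k)^2 ≤ A^2 * q * k * Real.exp (-(k*q/8)) := by
    intro k hk
    rw [← sq_abs, sq]
    calc _ ≤ (A * q * k) * (A * Real.exp (-(k*q/8))) := mul_le_mul (hlin k hk) (hD k hk) (abs_nonneg _) (by positivity)
      _ = _ := by ring
  have hterm : ∀ k ∈ Finset.range h, ((k+1) * (D (k+1) - D k)^2 + ((D k)^2 + (D (k+1))^2)/(2*(k+1))) ≤ 10 * A^2 * (q * (Real.exp (-(q/8)))^k) := by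
    intro k hk
    have hk := Finset.mem_range.1 hk
    have he : (Real.exp (-(q/8)))^k = Real.exp (-(k*q/8)) := by rw [← Real.exp_nat_mul]; congr 1; ring
    rw [he]
    set E := Real.exp (-(k*q/8)) with hE
    have E0 : 0 < E := Real.exp_pos _
    have E1 : E ≤ 1 := Real.exp_le_one_iff.2 (by have : 0 ≤ (k:ℝ)*q/8 := by positivity
                                                 linarith)
    have hkE : (k+1) * q * E ≤ 9 := by
      have h1 : (k*q/8) * E ≤ 1 := by
        have h2 : (k:ℝ)*q/8 ≤ Real.exp (k*q/8) := by linarith [Real.add_one_le_exp ((k:ℝ)*q/8)]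
        calc _ ≤ Real.exp (k*q/8) * E := mul_le_mul_of_nonneg_right h2 E0.le
          _ = 1 := by rw [hE, ← Real.exp_add]; simp
      have h2 : q * E ≤ 1 := mul_le_one₀ hq1 E0.le E1
      nlinarith
    have t1 : ((k:ℝ)+1) * (D (k+1) - D k)^2 ≤ 9 * A^2 * (q * E) := by
      have h1 : (D (k+1) - D k)^2 ≤ (A * q * E)^2 := by
        rw [← sq_abs]; exact pow_le_pow_left₀ (abs_nonneg _) (hstep k hk) 2
      calc _ ≤ ((k:ℝ)+1) * (A * q * E)^2 := mul_le_mul_of_nonneg_left h1 (by positivity)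
        _ = ((k+1) * q * E) * (A^2 * (q * E)) := by ring
        _ ≤ 9 * (A^2 * (q * E)) := mul_le_mul_of_nonneg_right hkE (by positivity)
        _ = _ := by ring
    have t2 : ((D k)^2 + (D (k+1))^2)/(2*(k+1)) ≤ A^2 * (q * E) := by
      rw [div_le_iff₀ (by positivity)]
      have h1 := hsq k hk.le
      have h2 := hsq (k+1) hk
      have h3 : Real.exp (-(((k+1:ℕ):ℝ)*q/8)) ≤ E := Real.exp_le_exp.2 (by push_cast; linarith)
      have h4 : A^2 * q * ((k+1:ℕ):ℝ) * Real.exp (-(((k+1:ℕ):ℝ)*q/8)) ≤ A^2 * q * ((k+1:ℕ):ℝ) * E := mul_le_mul_of_nonneg_left h3 (by positivity)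
      push_cast at h4 h2
      have h5 : 0 ≤ A^2 * q * E := by positivity
      linarith
    linarith
  refine (Finset.sum_le_sum hterm).trans ?_
  rw [← Finset.mul_sum, ← Finset.mul_sum]
  have hg : q * ∑ k ∈ Finset.range h, (Real.exp (-(q/8)))^k ≤ 9 := by
    rcases hq.eq_or_lt with h0 | h0
    · rw [← h0]; simp
    have hlt : Real.exp (-(q/8)) < 1 := by rw [← Real.exp_zero]; exact Real.exp_lt_exp.2 (by linarith)
    have hp := Real.exp_pos (-(q/8))
    have h1 : (∑ k ∈ Finset.range h, (Real.exp (-(q/8)))^k) * (1 - Real.exp (-(q/8))) ≤ 1 := by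
      have := geom_sum_mul (Real.exp (-(q/8))) h
      have h2 : 0 ≤ (Real.exp (-(q/8)))^h := by positivity
      linarith
    have h2 : q/9 ≤ 1 - Real.exp (-(q/8)) := by
      have h3 : Real.exp (-(q/8)) * (1 + q/8) ≤ 1 := by
        have h4 : 1 + q/8 ≤ Real.exp (q/8) := by linarith [Real.add_one_le_exp (q/8)]
        calc _ ≤ Real.exp (-(q/8)) * Real.exp (q/8) := mul_le_mul_of_nonneg_left h4 hp.le
          _ = 1 := by rw [← Real.exp_add]; simp
      nlinarith
    have h3 : 0 ≤ ∑ k ∈ Finset.range h, (Real.exp (-(q/8)))^k := Finset.sum_nonneg fun _ _ => by positivity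
    nlinarith
  nlinarith [sq_nonneg A]

/-- set of permutations whose first `k` values avoid `y` -/
def avoidSet (n k : ℕ) (y : Fin n → Bool) : Finset (Equiv.Perm (Fin n)) :=
  Finset.univ.filter fun σ => ∀ i : Fin n, i.1 < k → y (σ i) = false

noncomputable def rho (n k : ℕ) (y : Fin n → Bool) : ℝ := ((avoidSet n k y).card : ℝ) / (n.factorial : ℝ)

lemma rho_zero (n : ℕ) (y : Fin n → Bool) : rho n 0 y = 1 := by
  have : (n.factorial : ℝ) ≠ 0 := by exact_mod_cast n.factorial_ne_zero
  simp [rho, avoidSet, Fintype.card_perm, this]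

lemma rho_nonneg (n k : ℕ) (y : Fin n → Bool) : 0 ≤ rho n k y := by unfold rho; positivity

lemma rho_rec (n k : ℕ) (hk : k < n) (y : Fin n → Bool) :
    ((n:ℝ) - k) * (rho n k y - rho n (k+1) y) = wt y * rho n k y := by
  classical
  set K : Fin n := ⟨k, hk⟩
  have hbad : ∀ j : Fin n, k ≤ j.1 → ((avoidSet n k y).filter (fun σ => y (σ j) = true)).card
      = ((avoidSet n k y).filter (fun σ => y (σ K) = true)).card := by
    intro j hj
    apply Finset.card_bij' (fun σ _ => σ * Equiv.swap K j) (fun σ _ => σ * Equiv.swap K j)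
    · intro σ hσ
      simp only [avoidSet, Finset.mem_filter, Finset.mem_univ, true_and] at hσ ⊢
      refine ⟨fun i hi => ?_, ?_⟩
      · rw [Equiv.Perm.mul_apply, Equiv.swap_apply_of_ne_of_ne]
        · exact hσ.1 i hi
        · rintro rfl; exact lt_irrefl _ hi
        · rintro rfl; omega
      · simpa using hσ.2
    · intro σ hσ
      simp only [avoidSet, Finset.mem_filter, Finset.mem_univ, true_and] at hσ ⊢
      refine ⟨fun i hi => ?_, ?_⟩
      · rw [Equiv.Perm.mul_apply, Equiv.swap_apply_of_ne_of_ne]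
        · exact hσ.1 i hi
        · rintro rfl; exact lt_irrefl _ hi
        · rintro rfl; omega
      · simpa using hσ.2
    · intro σ _; simp [mul_assoc]
    · intro σ _; simp [mul_assoc]
  have hsplit : (avoidSet n (k+1) y).card + ((avoidSet n k y).filter (fun σ => y (σ K) = true)).card = (avoidSet n k y).card := by
    rw [← Finset.card_filter_add_card_filter_not (s := avoidSet n k y) (fun σ => y (σ K) = true), add_comm]
    congr 2
    ext σ
    simp only [avoidSet, Finset.mem_filter, Finset.mem_univ, true_and, Bool.not_eq_true]
    constructor
    · intro h; exact ⟨fun i hi => h i (by omega), h K (Nat.lt_succ_self k)⟩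
    · rintro ⟨h1, h2⟩ i hi
      rcases Nat.lt_succ_iff_lt_or_eq.1 hi with h | h
      · exact h1 i h
      · have : i = K := Fin.ext h
        rw [this]; exact h2
  have hcount : (n - k) * ((avoidSet n k y).filter (fun σ => y (σ K) = true)).card = wt y * (avoidSet n k y).card := by
    have h1 : ∑ j : Fin n with k ≤ j.1, ((avoidSet n k y).filter (fun σ => y (σ j) = true)).card = (n-k) * ((avoidSet n k y).filter (fun σ => y (σ K) = true)).card := by
      rw [Finset.sum_congr rfl (fun j hj => hbad j (Finset.mem_filter.1 hj).2), Finset.sum_const, smul_eq_mul]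
      congr 1
      have := Fin.card_Ici K
      rw [← this]
      congr 1
      ext j; simp [K, Fin.le_def]
    rw [← h1]
    simp only [Finset.card_filter]
    rw [Finset.sum_comm, mul_comm, ← smul_eq_mul, ← Finset.sum_const]
    apply Finset.sum_congr rfl
    intro σ hσ
    simp only [avoidSet, Finset.mem_filter, Finset.mem_univ, true_and] at hσ
    rw [← Finset.card_filter, Finset.filter_filter, wt]
    apply Finset.card_bij' (fun j _ => σ j) (fun j _ => σ⁻¹ j)
    · intro j hj; simp at hj ⊢; exact hj.2
    · intro j hj
      simp at hj ⊢
      refine ⟨?_, hj⟩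
      by_contra hc
      have := hσ (σ⁻¹ j) (not_le.1 hc)
      simp [hj] at this
    · intro j _; simp
    · intro j _; simp
  have h1 : ((avoidSet n (k+1) y).card : ℝ) + (((avoidSet n k y).filter (fun σ => y (σ K) = true)).card : ℝ) = (avoidSet n k y).card := by exact_mod_cast hsplit
  have h2 : ((n:ℝ) - k) * (((avoidSet n k y).filter (fun σ => y (σ K) = true)).card : ℝ) = wt y * (avoidSet n k y).card := by
    rw [← Nat.cast_sub hk.le]; exact_mod_cast hcount
  have hf : (n.factorial : ℝ) ≠ 0 := by exact_mod_cast n.factorial_ne_zero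
  unfold rho
  rw [← sub_div, ← h1, add_sub_cancel_left, h1]
  field_simp
  linarith

lemma wt_le {n : ℕ} (y : Fin n → Bool) : wt y ≤ n := by
  unfold wt; exact (Finset.card_le_univ _).trans (by simp)

lemma rho_bd (n : ℕ) (y : Fin n → Bool) : ∀ k ≤ n, rho n k y ≤ Real.exp (-(k*((wt y:ℝ)/n))) := by
  intro k hk
  induction k with
  | zero => simp [rho_zero]
  | succ k ih =>
    have ih := ih (by omega)
    have hr := rho_rec n k (by omega) y
    have h0 := rho_nonneg n k y
    have hk' : (k:ℝ) + 1 ≤ n := by exact_mod_cast hk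
    have hn : (0:ℝ) < n := by linarith [(Nat.cast_nonneg k : (0:ℝ) ≤ k)]
    set q := (wt y:ℝ)/n with hq
    have hq0 : 0 ≤ q := by positivity
    have e : (wt y : ℝ) = q * n := by rw [hq]; field_simp
    have hq1 : q ≤ 1 := by rw [hq, div_le_one hn]; exact_mod_cast wt_le y
    have h1 : rho n (k+1) y ≤ (1 - q) * rho n k y := by
      have hp : (0:ℝ) < n - k := by linarith
      have : ((n:ℝ)-k) * rho n (k+1) y ≤ (n-k) * ((1-q) * rho n k y) := by
        rw [e] at hr
        have : 0 ≤ q * k * rho n k y := by positivity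
        nlinarith
      exact le_of_mul_le_mul_left this hp
    have h2 : 1 - q ≤ Real.exp (-q) := by linarith [Real.add_one_le_exp (-q)]
    calc _ ≤ _ := h1
      _ ≤ Real.exp (-q) * Real.exp (-(k*q)) := mul_le_mul h2 ih h0 (Real.exp_pos _).le
      _ = _ := by rw [← Real.exp_add]; congr 1; push_cast; ring

lemma D_sum (n : ℕ) (y : Fin n → Bool) (hy : 2 * wt y ≤ n) :
    ∑ k ∈ Finset.range (n/2), (((k:ℝ)+1) * ((kr n (wt y) (k+1) - rho n (k+1) y) - (kr n (wt y) k - rho n k y))^2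
      + ((kr n (wt y) k - rho n k y)^2 + (kr n (wt y) (k+1) - rho n (k+1) y)^2)/(2*(k+1))) ≤ 9000 := by
  rcases Nat.eq_zero_or_pos n with h | hn
  · subst h; simp
  have hn' : (0:ℝ) < n := by exact_mod_cast hn
  have hq1 : (wt y:ℝ)/n ≤ 1 := by rw [div_le_one hn']; exact_mod_cast wt_le y
  have := mult_sum (fun k => kr n (wt y) k - rho n k y) (n/2) ((wt y:ℝ)/n) 10 (by positivity) hq1 (by norm_num)
    (by simp [kr_zero, rho_zero]) ?_ ?_
  · refine this.trans (by norm_num)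
  · intro k hk
    have h1 := kr_step n (wt y) k hy (by omega)
    have h2 := rho_bd n y k (by omega)
    have h3 := rho_rec n k (by omega) y
    have h0 := rho_nonneg n k y
    have hk2 : 2 * ((k:ℝ) + 1) ≤ n := by exact_mod_cast (by omega : 2 * (k+1) ≤ n)
    set q := (wt y:ℝ)/n with hq
    have hq0 : 0 ≤ q := by positivity
    have e : (wt y : ℝ) = q * n := by rw [hq]; field_simp
    have e1 : (k:ℝ)*wt y/(8*n) = k*q/8 := by rw [hq]; field_simp
    rw [e1] at h1
    have h4 : |rho n (k+1) y - rho n k y| ≤ 2 * q * Real.exp (-(k*q/8)) := by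
      rw [abs_sub_comm]
      have hp : (0:ℝ) < n - k := by linarith [(Nat.cast_nonneg k : (0:ℝ) ≤ k)]
      have h5 : rho n k y - rho n (k+1) y = wt y / (n-k) * rho n k y := by
        field_simp; linarith
      rw [h5, abs_of_nonneg (by positivity)]
      apply mul_le_mul _ _ h0 (by positivity)
      · rw [div_le_iff₀ hp, e]
        nlinarith
      · refine h2.trans (Real.exp_le_exp.2 ?_)
        have : 0 ≤ (k:ℝ) * q := by positivity
        linarith
    calc _ = |(kr n (wt y) (k+1) - kr n (wt y) k) - (rho n (k+1) y - rho n k y)| := by congr 1; ring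
      _ ≤ _ := abs_sub _ _
      _ ≤ _ := by linarith
  · intro k hk
    have h1 := kr_bd n (wt y) k hy (by omega)
    have h2 := rho_bd n y k (by omega)
    have h0 := rho_nonneg n k y
    set q := (wt y:ℝ)/n with hq
    have hq0 : 0 ≤ q := by positivity
    have e1 : (k:ℝ)*wt y/(4*n) = k*q/4 := by rw [hq]; field_simp
    rw [e1] at h1
    have hkq : 0 ≤ (k:ℝ) * q := by positivity
    have a1 : Real.exp (-(k*q/4)) ≤ Real.exp (-(k*q/8)) := Real.exp_le_exp.2 (by linarith)
    have a2 : Real.exp (-(k*q)) ≤ Real.exp (-(k*q/8)) := Real.exp_le_exp.2 (by linarith)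
    have a3 := Real.exp_pos (-(k*q/8))
    refine (abs_sub _ _).trans ?_
    rw [abs_of_nonneg h0]
    linarith

lemma chiR_orth {n : ℕ} (y y' : Fin n → Bool) :
    ∑ x, chiR y x * chiR y' x = if y = y' then (2:ℝ)^n else 0 := by
  have h1 : ∀ x : Fin n → Bool, chiR y x * chiR y' x =
      ∏ j, (fun (j : Fin n) (b : Bool) => (if b = true ∧ y j = true then (-1:ℝ) else 1) * (if b = true ∧ y' j = true then (-1:ℝ) else 1)) j (x j) := by
    intro x
    unfold chiR
    rw [← Finset.prod_mul_distrib]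
  have h3 := Fintype.prod_sum (fun (j : Fin n) (b : Bool) => (if b = true ∧ y j = true then (-1:ℝ) else 1) * (if b = true ∧ y' j = true then (-1:ℝ) else 1))
  rw [Finset.sum_congr rfl fun x _ => h1 x]
  refine h3.symm.trans ?_
  have h2 : ∀ j : Fin n, ∑ b : Bool, (if b = true ∧ y j = true then (-1:ℝ) else 1) * (if b = true ∧ y' j = true then (-1:ℝ) else 1) = if y j = y' j then 2 else 0 := by
    intro j
    rw [Fintype.sum_bool]
    cases y j <;> cases y' j <;> norm_num
  simp_rw [h2]
  split_ifs with h
  · subst h; simp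
  · have : ∃ j, y j ≠ y' j := by
      by_contra hc; push Not at hc; exact h (funext hc)
    obtain ⟨j, hj⟩ := this
    exact Finset.prod_eq_zero (Finset.mem_univ j) (by simp [hj])

/-- Normalized Fourier coefficient. -/
noncomputable def cf {n : ℕ} (f : (Fin n → Bool) → ℂ) (y : Fin n → Bool) : ℂ :=
  ((2:ℂ)^n)⁻¹ * ∑ x, f x * (chiR y x : ℂ)

lemma chiR_orthC {n : ℕ} (y y' : Fin n → Bool) :
    ∑ x, (chiR y x : ℂ) * (chiR y' x : ℂ) = if y = y' then (2:ℂ)^n else 0 := by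
  have := congrArg (fun z : ℝ => (z:ℂ)) (chiR_orth y y')
  simp only [Complex.ofReal_sum, Complex.ofReal_mul] at this
  rw [this]; split_ifs <;> simp

lemma cf_inv {n : ℕ} (f : (Fin n → Bool) → ℂ) (x : Fin n → Bool) :
    f x = ∑ y, cf f y * (chiR y x : ℂ) := by
  unfold cf
  have h : ∀ y : Fin n → Bool, ((2:ℂ)^n)⁻¹ * (∑ z, f z * (chiR y z : ℂ)) * (chiR y x : ℂ)
      = ∑ z, ((2:ℂ)^n)⁻¹ * f z * ((chiR z y : ℂ) * (chiR x y : ℂ)) := by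
    intro y
    rw [Finset.mul_sum, Finset.sum_mul]
    refine Finset.sum_congr rfl fun z _ => ?_
    rw [chiR_comm y z, chiR_comm y x]; ring
  simp_rw [h]
  rw [Finset.sum_comm]
  simp_rw [← Finset.mul_sum, chiR_orthC]
  have h2 : (2:ℂ)^n ≠ 0 := pow_ne_zero _ two_ne_zero
  simp
  field_simp

lemma parseval {n : ℕ} (b : (Fin n → Bool) → ℂ) :
    ∑ x, ‖∑ y, b y * (chiR y x : ℂ)‖^2 = (2:ℝ)^n * ∑ y, ‖b y‖^2 := by
  have key : ((∑ x, ‖∑ y, b y * (chiR y x : ℂ)‖^2 : ℝ) : ℂ) = (((2:ℝ)^n * ∑ y, ‖b y‖^2 : ℝ) : ℂ) := by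
    push_cast
    have hn : ∀ z : ℂ, (‖z‖:ℂ)^2 = z * (starRingEnd ℂ) z := fun z => by
      rw [Complex.mul_conj, Complex.normSq_eq_norm_sq]; push_cast; rfl
    simp_rw [hn, map_sum, map_mul, Complex.conj_ofReal, Finset.sum_mul_sum]
    rw [Finset.sum_comm]
    rw [Finset.mul_sum]
    refine Finset.sum_congr rfl fun y _ => ?_
    rw [Finset.sum_comm]
    have : ∀ y', ∑ x, b y * (chiR y x : ℂ) * ((starRingEnd ℂ) (b y') * (chiR y' x : ℂ)) = b y * (starRingEnd ℂ) (b y') * if y = y' then (2:ℂ)^n else 0 := by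
      intro y'
      rw [← chiR_orthC, Finset.mul_sum]
      exact Finset.sum_congr rfl fun x _ => by ring
    simp_rw [this]
    simp
    ring
  exact_mod_cast key

lemma parseval_f {n : ℕ} (f : (Fin n → Bool) → ℂ) : ∑ x, ‖f x‖^2 = (2:ℝ)^n * ∑ y, ‖cf f y‖^2 := by
  rw [← parseval]
  exact Finset.sum_congr rfl fun x _ => by rw [← cf_inv]

lemma cf_supp {n : ℕ} (f : (Fin n → Bool) → ℂ)
    (hf : ∀ y : Fin n → Bool, (n : ℝ) / 2 < (wt y : ℝ) → fourierT f y = 0) (y : Fin n → Bool)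
    (hy : ¬ 2 * wt y ≤ n) : cf f y = 0 := by
  have h := hf y (by
    have : n < 2 * wt y := by omega
    have : (n:ℝ) < 2 * wt y := by exact_mod_cast this
    linarith)
  unfold fourierT at h
  have h2 : ((Real.sqrt (2 ^ n) : ℂ))⁻¹ ≠ 0 := by
    have : (0:ℝ) < Real.sqrt (2^n) := by positivity
    exact inv_ne_zero (by exact_mod_cast this.ne')
  have h3 := (mul_eq_zero.1 h).resolve_left h2
  unfold cf
  simp_rw [chi_eq] at h3
  rw [h3, mul_zero]

lemma parseval_bd {n : ℕ} (f : (Fin n → Bool) → ℂ)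
    (hf : ∀ y : Fin n → Bool, ¬ 2 * wt y ≤ n → cf f y = 0)
    (m : (Fin n → Bool) → ℝ) (M : ℝ) (hm : ∀ y, 2 * wt y ≤ n → |m y| ≤ M) (hM : 0 ≤ M) :
    ∑ x, ‖∑ y, (m y : ℂ) * cf f y * (chiR y x : ℂ)‖^2 ≤ M^2 * ∑ x, ‖f x‖^2 := by
  rw [parseval (fun y => (m y : ℂ) * cf f y), parseval_f f]
  rw [mul_left_comm (M^2) ((2:ℝ)^n)]
  refine mul_le_mul_of_nonneg_left ?_ (by positivity : (0:ℝ) ≤ 2^n)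
  rw [Finset.mul_sum]
  refine Finset.sum_le_sum fun y _ => ?_
  by_cases hy : 2 * wt y ≤ n
  · rw [norm_mul, mul_pow, Complex.norm_real, Real.norm_eq_abs]
    exact mul_le_mul_of_nonneg_right (pow_le_pow_left₀ (abs_nonneg _) (hm y hy) 2) (by positivity)
  · simp [hf y hy]

lemma sph_eq {n : ℕ} (k : ℕ) (f : (Fin n → Bool) → ℂ) (x : Fin n → Bool) :
    sphMean n k f x = ∑ y, (kr n (wt y) k : ℂ) * cf f y * (chiR y x : ℂ) := by
  have h1 : ∀ z : Fin n → Bool, hammingDist x z = wt (fun j => xor (x j) (z j)) := by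
    intro z
    unfold hammingDist wt
    congr 1
    ext j
    simp
  have h2 : ∑ y ∈ Finset.univ.filter (fun y => hammingDist x y = k), f y
      = ∑ w ∈ Finset.univ.filter (fun w : Fin n → Bool => wt w = k), f (fun j => xor (x j) (w j)) := by
    refine Finset.sum_nbij' (fun z j => xor (x j) (z j)) (fun z j => xor (x j) (z j)) ?_ ?_ ?_ ?_ ?_
    · intro z hz; simp only [Finset.mem_filter, Finset.mem_univ, true_and] at hz ⊢; rw [← h1]; exact hz
    · intro z hz; simp only [Finset.mem_filter, Finset.mem_univ, true_and] at hz ⊢; rw [h1]; simpa using hz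
    · intro z hz; simp
    · intro z hz; simp
    · intro z hz; simp
  have h3 : ∀ y w : Fin n → Bool, chiR y (fun j => xor (x j) (w j)) = chiR y x * chiR y w := by
    intro y w
    unfold chiR
    rw [← Finset.prod_mul_distrib]
    refine Finset.prod_congr rfl fun j _ => ?_
    have hh : ∀ a b c : Bool, (if (xor a b) = true ∧ c = true then (-1:ℝ) else 1) =
        (if a = true ∧ c = true then (-1:ℝ) else 1) * (if b = true ∧ c = true then (-1:ℝ) else 1) := by
      intro a b c
      cases a <;> cases b <;> cases c <;> norm_num
    exact hh (x j) (w j) (y j)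
  unfold sphMean
  rw [h2]
  simp_rw [fun w : Fin n → Bool => cf_inv f (fun j => xor (x j) (w j)), h3]
  rw [Finset.sum_comm, Finset.mul_sum]
  refine Finset.sum_congr rfl fun y _ => ?_
  unfold kr
  rw [coeff_kp]
  push_cast
  rw [Finset.sum_div, Finset.sum_mul, Finset.sum_mul, Finset.mul_sum]
  refine Finset.sum_congr rfl fun w _ => ?_
  ring

lemma sph_reflect {n : ℕ} (k : ℕ) (hk : k ≤ n) (f : (Fin n → Bool) → ℂ) (x : Fin n → Bool) :
    sphMean n k f x = sphMean n (n-k) f (fun j => !x j) := by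
  unfold sphMean
  rw [Nat.choose_symm hk]
  congr 1
  refine Finset.sum_congr ?_ fun _ _ => rfl
  ext y
  simp only [Finset.mem_filter, Finset.mem_univ, true_and]
  have : hammingDist x y + hammingDist (fun j => !x j) y = n := by
    unfold hammingDist
    have := Finset.card_filter_add_card_filter_not (s := (Finset.univ : Finset (Fin n))) (fun j => x j ≠ y j)
    simp only [Finset.card_univ, Fintype.card_fin] at this
    have e : (Finset.univ.filter fun j => (fun j => !x j) j ≠ y j) = Finset.univ.filter fun j => ¬ (x j ≠ y j) := by
      ext j
      simp only [Finset.mem_filter, Finset.mem_univ, true_and]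
      cases x j <;> cases y j <;> simp
    rw [e]
    exact this
  omega

/-- Averages of `f` over the subcube of the first `k` coordinates in the order `σ`. -/
noncomputable def gs {n : ℕ} (f : (Fin n → Bool) → ℂ) (σ : Equiv.Perm (Fin n)) (k : ℕ) (x : Fin n → Bool) : ℂ :=
  ∑ y, (if σ ∈ avoidSet n k y then cf f y else 0) * (chiR y x : ℂ)

lemma chiR_flip {n : ℕ} (y x : Fin n → Bool) (j : Fin n) :
    chiR y (Function.update x j (!x j)) = (if y j = true then -1 else 1) * chiR y x := by
  unfold chiR
  rw [← Finset.mul_prod_erase Finset.univ _ (Finset.mem_univ j),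
    ← Finset.mul_prod_erase Finset.univ (fun i => if x i = true ∧ y i = true then (-1:ℝ) else 1) (Finset.mem_univ j), ← mul_assoc]
  congr 1
  · simp only [Function.update_self]
    cases x j <;> cases y j <;> norm_num
  · refine Finset.prod_congr rfl fun i hi => ?_
    rw [Function.update_of_ne (Finset.ne_of_mem_erase hi)]

lemma gs_flip {n : ℕ} (f : (Fin n → Bool) → ℂ) (σ : Equiv.Perm (Fin n)) (k : ℕ) (i : Fin n) (hi : i.1 < k)
    (x : Fin n → Bool) : gs f σ k (Function.update x (σ i) (!x (σ i))) = gs f σ k x := by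
  unfold gs
  refine Finset.sum_congr rfl fun y _ => ?_
  split_ifs with h
  · have h' := (Finset.mem_filter.1 h).2 i hi
    rw [chiR_flip, h']; simp
  · simp

lemma gs_mart {n : ℕ} (f : (Fin n → Bool) → ℂ) (σ : Equiv.Perm (Fin n)) :
    MartH n (fun i => gs f σ (n - i)) := by
  intro i hi φ hφ
  have h1 : ∀ y : Fin n → Bool,
      ((if σ ∈ avoidSet n (n-(i+1)) y then cf f y else 0) - (if σ ∈ avoidSet n (n-i) y then cf f y else 0)) * ∑ x, φ x * (chiR y x : ℂ) = 0 := by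
    intro y
    by_cases hy : σ ∈ avoidSet n (n-i) y
    · have : σ ∈ avoidSet n (n-(i+1)) y := by
        refine Finset.mem_filter.2 ⟨Finset.mem_univ _, fun l hl => (Finset.mem_filter.1 hy).2 l (by omega)⟩
      simp [hy, this]
    · have h2 : ∃ l : Fin n, l.1 < n - i ∧ y (σ l) = true := by
        by_contra hc
        push Not at hc
        exact hy (Finset.mem_filter.2 ⟨Finset.mem_univ _, fun l hl => by simpa using hc l hl⟩)
      obtain ⟨l, hl, hyl⟩ := h2
      have h3 : ∑ x, φ x * (chiR y x : ℂ) = ∑ x, -(φ x * (chiR y x : ℂ)) := by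
        refine Fintype.sum_equiv ⟨fun x => Function.update x (σ l) (!x (σ l)), fun x => Function.update x (σ l) (!x (σ l)), fun x => by simp, fun x => by simp⟩ _ _ fun x => ?_
        simp only [Equiv.coe_fn_mk]
        rw [chiR_flip, hyl, hφ (Function.update x (σ l) (!x (σ l))) x (fun j hj => gs_flip f σ (n-j) l (by omega) x)]
        simp
      rw [Finset.sum_neg_distrib] at h3
      rw [self_eq_neg.1 h3, mul_zero]
  have h4 : ∀ x, φ x * (gs f σ (n-(i+1)) x - gs f σ (n-i) x) = ∑ y, ((if σ ∈ avoidSet n (n-(i+1)) y then cf f y else 0) - (if σ ∈ avoidSet n (n-i) y then cf f y else 0)) * (φ x * (chiR y x : ℂ)) := by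
    intro x
    unfold gs
    rw [← Finset.sum_sub_distrib, Finset.mul_sum]
    exact Finset.sum_congr rfl fun y _ => by ring
  rw [Finset.sum_congr rfl fun x _ => h4 x, Finset.sum_comm]
  simp_rw [← Finset.mul_sum]
  exact Finset.sum_eq_zero fun y _ => h1 y

lemma gs_zero {n : ℕ} (f : (Fin n → Bool) → ℂ) (σ : Equiv.Perm (Fin n)) (x : Fin n → Bool) : gs f σ 0 x = f x := by
  unfold gs
  rw [cf_inv f x]
  refine Finset.sum_congr rfl fun y _ => ?_
  simp [avoidSet]

lemma gs_avg {n : ℕ} (f : (Fin n → Bool) → ℂ) (k : ℕ) (x : Fin n → Bool) :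
    ∑ σ : Equiv.Perm (Fin n), (((n.factorial:ℝ)⁻¹ : ℝ) : ℂ) * gs f σ k x = ∑ y, (rho n k y : ℂ) * cf f y * (chiR y x : ℂ) := by
  unfold gs
  rw [← Finset.mul_sum, Finset.sum_comm, Finset.mul_sum]
  refine Finset.sum_congr rfl fun y _ => ?_
  rw [← Finset.sum_mul, ← Finset.sum_filter]
  unfold rho
  have : (Finset.univ.filter fun σ => σ ∈ avoidSet n k y) = avoidSet n k y := by ext; simp
  rw [this, Finset.sum_const, nsmul_eq_mul]
  push_cast
  ring

noncomputable def Lc (r : ℝ) : ℝ := ((64*4^(r-2))^(2/r)*(4+1/(1-(1/2:ℝ)^(r-2))))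

lemma rho_var {n : ℕ} (r : ℝ) (hr : 2 < r) (f : (Fin n → Bool) → ℂ) : ∃ B : (Fin n → Bool) → ℝ, (∀ x, 0 ≤ B x) ∧
    ∑ x, (B x)^2 ≤ Lc r * ∑ x, ‖f x‖^2 ∧
    ∀ x, VarLE r n (fun k => ∑ y, (rho n k y : ℂ) * cf f y * (chiR y x : ℂ)) (B x) := by
  have h1 : ∀ σ : Equiv.Perm (Fin n), ∃ B : (Fin n → Bool) → ℝ, (∀ x, 0 ≤ B x) ∧
    ∑ x, (B x)^2 ≤ Lc r * ∑ x, ‖f x‖^2 ∧ ∀ x, VarLE r n (fun k => gs f σ k x) (B x) := by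
    intro σ
    obtain ⟨B, h0, h2, h3⟩ := lepingle n (fun i => gs f σ (n-i)) r hr (gs_mart f σ)
    refine ⟨B, h0, ?_, fun x => ?_⟩
    · simp only [Nat.sub_self, gs_zero] at h2
      exact h2
    · have h4 := (h3 x).rev n
      intro J t ht htn
      have := h4 J t ht htn
      have e : ∀ j, n - min (n - t j) n = t j := fun j => by have := htn j; omega
      simp only [e] at this
      exact this
  choose B hB0 hB1 hB2 using h1
  have hfac : (0:ℝ) < n.factorial := by exact_mod_cast n.factorial_pos
  refine ⟨fun x => ∑ σ, (n.factorial:ℝ)⁻¹ * B σ x, fun x => Finset.sum_nonneg fun σ _ => mul_nonneg (by positivity) (hB0 σ x), ?_, fun x => ?_⟩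
  · have h2 : ∀ x, (∑ σ, (n.factorial:ℝ)⁻¹ * B σ x)^2 ≤ ∑ σ, (n.factorial:ℝ)⁻¹ * (B σ x)^2 := by
      intro x
      rw [← Finset.mul_sum, ← Finset.mul_sum]
      have := sq_sum_le_card_mul_sum_sq (s := (Finset.univ : Finset (Equiv.Perm (Fin n)))) (f := fun σ => B σ x)
      rw [Finset.card_univ, Fintype.card_perm, Fintype.card_fin] at this
      rw [mul_pow]
      calc _ ≤ ((n.factorial:ℝ)⁻¹)^2 * (n.factorial * ∑ σ, B σ x ^2) := mul_le_mul_of_nonneg_left this (by positivity)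
        _ = _ := by field_simp
    refine (Finset.sum_le_sum fun x _ => h2 x).trans ?_
    rw [Finset.sum_comm]
    simp_rw [← Finset.mul_sum]
    calc _ ≤ (n.factorial:ℝ)⁻¹ * ∑ σ : Equiv.Perm (Fin n), (Lc r * ∑ x, ‖f x‖^2) :=
          mul_le_mul_of_nonneg_left (Finset.sum_le_sum fun σ _ => hB1 σ) (by positivity)
      _ = _ := by
        rw [Finset.sum_const, Finset.card_univ, Fintype.card_perm, Fintype.card_fin, nsmul_eq_mul]
        field_simp
  · simp_rw [← gs_avg]
    exact VarLE.sum (by linarith) Finset.univ _ _ (fun σ => mul_nonneg (by positivity) (hB0 σ x)) fun σ =>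
      VarLE.smul (by linarith) (hB0 σ x) (hB2 σ x) _ (by positivity)

lemma d_var {n : ℕ} (r : ℝ) (hr : 2 < r) (f : (Fin n → Bool) → ℂ)
    (hf : ∀ y : Fin n → Bool, ¬ 2 * wt y ≤ n → cf f y = 0) : ∃ B : (Fin n → Bool) → ℝ, (∀ x, 0 ≤ B x) ∧
    ∑ x, (B x)^2 ≤ 18000 * ∑ x, ‖f x‖^2 ∧
    ∀ x, VarLE r (n/2) (fun k => ∑ y, ((kr n (wt y) k - rho n k y : ℝ) : ℂ) * cf f y * (chiR y x : ℂ)) (B x) := by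
  refine ⟨_, fun x => Real.sqrt_nonneg _, ?_, fun x => VarLE.of_steps hr (n/2) _⟩
  set d : ℕ → (Fin n → Bool) → ℝ := fun k y => kr n (wt y) k - rho n k y with hd
  have hP : ∀ m : (Fin n → Bool) → ℝ, ∑ x, ‖∑ y, (m y : ℂ) * cf f y * (chiR y x : ℂ)‖^2 = 2^n * ∑ y, (m y)^2 * ‖cf f y‖^2 := by
    intro m
    rw [parseval (fun y => (m y : ℂ) * cf f y)]
    simp only [norm_mul, mul_pow, Complex.norm_real, Real.norm_eq_abs, sq_abs]
  have hdiff : ∀ k x, (∑ y, (d (k+1) y : ℂ) * cf f y * (chiR y x : ℂ)) - (∑ y, (d k y : ℂ) * cf f y * (chiR y x : ℂ))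
      = ∑ y, ((d (k+1) y - d k y : ℝ) : ℂ) * cf f y * (chiR y x : ℂ) := by
    intro k x
    rw [← Finset.sum_sub_distrib]
    refine Finset.sum_congr rfl fun y _ => ?_
    push_cast; ring
  have hsq : ∀ x, (Real.sqrt (∑ k ∈ Finset.range (n/2), 2*(((k:ℝ)+1)*‖(∑ y, (d (k+1) y : ℂ) * cf f y * (chiR y x : ℂ)) - (∑ y, (d k y : ℂ) * cf f y * (chiR y x : ℂ))‖^2 + (‖∑ y, (d k y : ℂ) * cf f y * (chiR y x : ℂ)‖^2+‖∑ y, (d (k+1) y : ℂ) * cf f y * (chiR y x : ℂ)‖^2)/(2*((k:ℝ)+1)))))^2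
      = ∑ k ∈ Finset.range (n/2), 2*(((k:ℝ)+1)*‖∑ y, ((d (k+1) y - d k y : ℝ) : ℂ) * cf f y * (chiR y x : ℂ)‖^2 + (‖∑ y, (d k y : ℂ) * cf f y * (chiR y x : ℂ)‖^2+‖∑ y, (d (k+1) y : ℂ) * cf f y * (chiR y x : ℂ)‖^2)/(2*((k:ℝ)+1))) := by
    intro x
    rw [Real.sq_sqrt (Finset.sum_nonneg fun k _ => by positivity)]
    exact Finset.sum_congr rfl fun k _ => by rw [hdiff]
  refine (le_of_eq (Finset.sum_congr rfl fun x _ => hsq x)).trans ?_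
  rw [Finset.sum_comm]
  simp_rw [← Finset.mul_sum, Finset.sum_add_distrib, ← Finset.sum_div, ← Finset.mul_sum, Finset.sum_add_distrib, hP]
  rw [parseval_f f]
  have e : ∀ k ∈ Finset.range (n/2), (((k:ℝ)+1) * (2^n * ∑ y, (d (k+1) y - d k y)^2 * ‖cf f y‖^2)) + (2^n * ∑ y, (d k y)^2 * ‖cf f y‖^2 + 2^n * ∑ y, (d (k+1) y)^2 * ‖cf f y‖^2)/(2*((k:ℝ)+1))
      = 2^n * ∑ y, ‖cf f y‖^2 * (((k:ℝ)+1) * (d (k+1) y - d k y)^2 + ((d k y)^2 + (d (k+1) y)^2)/(2*(k+1))) := by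
    intro k _
    simp only [Finset.mul_sum, ← Finset.sum_add_distrib, Finset.sum_div]
    refine Finset.sum_congr rfl fun y _ => ?_
    ring
  have e2 := Finset.sum_congr rfl e
  rw [Finset.sum_add_distrib] at e2
  rw [e2, ← Finset.mul_sum, Finset.sum_comm]
  have e3 : ∑ y, ∑ k ∈ Finset.range (n/2), ‖cf f y‖^2 * (((k:ℝ)+1) * (d (k+1) y - d k y)^2 + ((d k y)^2 + (d (k+1) y)^2)/(2*(k+1))) ≤ ∑ y, 9000 * ‖cf f y‖^2 := by
    refine Finset.sum_le_sum fun y _ => ?_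
    rw [← Finset.mul_sum]
    by_cases hy : 2 * wt y ≤ n
    · have := D_sum n y hy
      rw [mul_comm]
      exact mul_le_mul_of_nonneg_right this (by positivity)
    · simp [hf y hy]
  rw [← Finset.mul_sum] at e3
  have : (0:ℝ) ≤ 2^n := by positivity
  nlinarith [mul_le_mul_of_nonneg_left e3 this]

lemma half_var {n : ℕ} (r : ℝ) (hr : 2 < r) (f : (Fin n → Bool) → ℂ)
    (hf : ∀ y : Fin n → Bool, ¬ 2 * wt y ≤ n → cf f y = 0) : ∃ B : (Fin n → Bool) → ℝ, (∀ x, 0 ≤ B x) ∧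
    ∑ x, (B x)^2 ≤ (2 * Lc r + 36000) * ∑ x, ‖f x‖^2 ∧
    ∀ x, VarLE r (n/2) (fun k => sphMean n k f x) (B x) := by
  obtain ⟨B1, h1, h1s, h1v⟩ := rho_var r hr f
  obtain ⟨B2, h2, h2s, h2v⟩ := d_var r hr f hf
  refine ⟨fun x => B1 x + B2 x, fun x => add_nonneg (h1 x) (h2 x), ?_, fun x => ?_⟩
  · have : ∑ x, (B1 x + B2 x)^2 ≤ 2 * ∑ x, (B1 x)^2 + 2 * ∑ x, (B2 x)^2 := by
      rw [Finset.mul_sum, Finset.mul_sum, ← Finset.sum_add_distrib]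
      exact Finset.sum_le_sum fun x _ => by nlinarith [sq_nonneg (B1 x - B2 x)]
    linarith
  · have h3 : VarLE r (n/2) (fun k => ∑ y, (rho n k y : ℂ) * cf f y * (chiR y x : ℂ)) (B1 x) :=
      fun J t ht htn => h1v x J t ht fun j => (htn j).trans (Nat.div_le_self n 2)
    have h4 := VarLE.add (by linarith) (h1 x) (h2 x) h3 (h2v x)
    have e : (fun k => sphMean n k f x) = fun k => (∑ y, (rho n k y : ℂ) * cf f y * (chiR y x : ℂ)) + ∑ y, ((kr n (wt y) k - rho n k y : ℝ) : ℂ) * cf f y * (chiR y x : ℂ) := by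
      funext k
      rw [sph_eq, ← Finset.sum_add_distrib]
      refine Finset.sum_congr rfl fun y _ => ?_
      push_cast; ring
    rw [e]
    exact h4

lemma sum_compl {n : ℕ} (F : (Fin n → Bool) → ℝ) : ∑ x : Fin n → Bool, F (fun j => !x j) = ∑ x, F x :=
  Fintype.sum_equiv ⟨fun x j => !x j, fun x j => !x j, fun x => by simp, fun x => by simp⟩ _ _ fun x => rfl

lemma full_var {n : ℕ} (r : ℝ) (hr : 2 < r) (f : (Fin n → Bool) → ℂ)
    (hf : ∀ y : Fin n → Bool, ¬ 2 * wt y ≤ n → cf f y = 0) : ∃ B : (Fin n → Bool) → ℝ, (∀ x, 0 ≤ B x) ∧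
    ∑ x, (B x)^2 ≤ (8 * (2 * Lc r + 36000) + 32) * ∑ x, ‖f x‖^2 ∧
    ∀ x, VarLE r n (fun k => sphMean n k f x) (B x) := by
  obtain ⟨B, h0, hs, hv⟩ := half_var r hr f hf
  set S : (Fin n → Bool) → ℂ := fun x => sphMean n (n/2) f x with hS
  have hSs : ∑ x, ‖S x‖^2 ≤ 4 * ∑ x, ‖f x‖^2 := by
    have := parseval_bd f hf (fun y => kr n (wt y) (n/2)) 2 (fun y hy => by
      refine (kr_bd n (wt y) (n/2) hy (by omega)).trans ?_
      have : Real.exp (-(((n/2 : ℕ):ℝ)*(wt y)/(4*n))) ≤ 1 := by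
        rw [← Real.exp_zero]; exact Real.exp_le_exp.2 (by rw [neg_nonpos]; positivity)
      linarith) (by norm_num)
    simp_rw [← sph_eq] at this
    norm_num at this
    exact this
  refine ⟨fun x => (B x + B (fun j => !x j)) + ‖-S (fun j => !x j) - -S x‖, fun x => ?_, ?_, fun x => ?_⟩
  · have := h0 x
    have := h0 (fun j => !x j)
    positivity
  · have h1 : ∀ x, ((B x + B (fun j => !x j)) + ‖-S (fun j => !x j) - -S x‖)^2 ≤ 4 * ((B x)^2 + (B (fun j => !x j))^2 + ‖S x‖^2 + ‖S (fun j => !x j)‖^2) := by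
      intro x
      have h2 : ‖-S (fun j => !x j) - -S x‖ ≤ ‖S (fun j => !x j)‖ + ‖S x‖ := by
        refine (norm_sub_le _ _).trans ?_
        rw [norm_neg, norm_neg]
      have hw0 := norm_nonneg (-S (fun j => !x j) - -S x)
      have a := h0 x
      have b := h0 (fun j => !x j)
      generalize B x = p at *
      generalize B (fun j => !x j) = q at *
      generalize ‖-S (fun j => !x j) - -S x‖ = w at *
      generalize ‖S (fun j => !x j)‖ = u at *
      generalize ‖S x‖ = v at *
      have hw : 0 ≤ w := hw0
      have : (p + q + w)^2 ≤ (p + q + (u + v))^2 := pow_le_pow_left₀ (by positivity) (by linarith) 2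
      nlinarith [sq_nonneg (p-q), sq_nonneg (u-v), sq_nonneg (p+q-(u+v))]
    refine (Finset.sum_le_sum fun x _ => h1 x).trans ?_
    rw [← Finset.mul_sum]
    simp only [Finset.sum_add_distrib]
    rw [sum_compl (fun x => (B x)^2), sum_compl (fun x => ‖S x‖^2)]
    linarith
  · have v1 := (hv x).clamp n
    have v2 := (hv (fun j => !x j)).rev n
    have v3 := VarLE.jump hr n (n/2) (-S (fun j => !x j)) (-S x)
    have v4 := VarLE.add (by linarith) (add_nonneg (h0 x) (h0 _)) (norm_nonneg _) (VarLE.add (by linarith) (h0 x) (h0 _) v1 v2) v3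
    intro J t ht htn
    refine le_trans (le_of_eq ?_) (v4 J t ht htn)
    have e : ∀ k ≤ n, sphMean n k f x = sphMean n (min k (n/2)) f x + sphMean n (min (n-k) (n/2)) f (fun j => !x j) + (if k ≤ n/2 then -S (fun j => !x j) else -S x) := by
      intro k hk
      split_ifs with h
      · rw [min_eq_left h, min_eq_right (by omega)]
        simp [hS]
      · rw [min_eq_right (by omega), min_eq_left (by omega), sph_reflect k hk f x]
        simp [hS]
    refine Finset.sum_congr rfl fun j _ => ?_
    simp only
    rw [e _ (htn (j+1)), e _ (htn j)]

lemma eVar_le (r : ℝ) (hr : 2 < r) (n : ℕ) (a : ℕ → ℂ) (B : ℝ) (hB : 0 ≤ B) (h : VarLE r n a B) :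
    eVar r a (Set.Iic n) ≤ ENNReal.ofReal B := by
  unfold eVar
  refine iSup_le fun J => iSup_le fun t => iSup_le fun ht => iSup_le fun htn => ?_
  have hr0 : 0 < r := by linarith
  rw [ENNReal.rpow_inv_le_iff hr0, ENNReal.ofReal_rpow_of_nonneg hB hr0.le]
  have h1 := h J (fun j => t ⟨min j J, by omega⟩) (fun i j hij => ht.monotone (by
    simp only [Fin.mk_le_mk]; omega)) (fun j => htn _)
  rw [← Fin.sum_univ_eq_sum_range (fun j => ‖a (t ⟨min (j+1) J, by omega⟩) - a (t ⟨min j J, by omega⟩)‖^r)] at h1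
  refine le_trans (le_of_eq ?_) (ENNReal.ofReal_le_ofReal h1)
  rw [ENNReal.ofReal_sum_of_nonneg (fun i _ => by positivity)]
  refine Finset.sum_congr rfl fun j _ => ?_
  rw [ENNReal.ofReal_rpow_of_nonneg (norm_nonneg _) hr0.le, norm_sub_rev]
  have e1 : (⟨min (j.1+1) J, by omega⟩ : Fin (J+1)) = j.succ := by ext; simp
  have e2 : (⟨min j.1 J, by omega⟩ : Fin (J+1)) = j.castSucc := by ext; simp
  rw [e1, e2]

/-- Dimension-free `ℓ²` bound for the `r`-variation of spherical means over all radii,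
for functions whose Fourier transform vanishes for `|y| > n/2`. -/
theorem statement5 (r : ℝ) (hr : 2 < r) :
    ∃ C : ℝ, 0 < C ∧ ∀ (n : ℕ) (f : (Fin n → Bool) → ℂ),
      (∀ y : Fin n → Bool, (n : ℝ) / 2 < (wt y : ℝ) → fourierT f y = 0) →
      eL2 (fun x => eVar r (fun k => sphMean n k f x) (Set.Iic n)) ≤
        ENNReal.ofReal (C * l2Norm f) := by
  refine ⟨Real.sqrt (8 * (2 * Lc r + 36000) + 32) + 1, by positivity, fun n f hf => ?_⟩
  obtain ⟨B, h0, hs, hv⟩ := full_var r hr f (cf_supp f hf)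
  have hP : 0 ≤ 8 * (2 * Lc r + 36000) + 32 := by
    have : 0 ≤ Lc r := by
      unfold Lc
      have : (1/2:ℝ)^(r-2) < 1 := Real.rpow_lt_one (by norm_num) (by norm_num) (by linarith)
      have : 0 < 1 - (1/2:ℝ)^(r-2) := by linarith
      positivity
    linarith
  unfold eL2
  rw [ENNReal.rpow_inv_le_iff (by norm_num)]
  have h1 : ∀ x, eVar r (fun k => sphMean n k f x) (Set.Iic n) ^ (2:ℝ) ≤ ENNReal.ofReal ((B x)^2) := by
    intro x
    refine (ENNReal.rpow_le_rpow (eVar_le r hr n _ (B x) (h0 x) (hv x)) (by norm_num)).trans ?_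
    rw [ENNReal.ofReal_rpow_of_nonneg (h0 x) (by norm_num), Real.rpow_two]
  refine (Finset.sum_le_sum fun x _ => h1 x).trans ?_
  rw [← ENNReal.ofReal_sum_of_nonneg (fun x _ => by positivity),
    ENNReal.ofReal_rpow_of_nonneg (by unfold l2Norm; positivity) (by norm_num)]
  refine ENNReal.ofReal_le_ofReal (hs.trans ?_)
  have h2 : (0:ℝ) ≤ ∑ x, ‖f x‖^2 := Finset.sum_nonneg fun x _ => by positivity
  rw [Real.rpow_two, mul_pow]
  unfold l2Norm
  rw [Real.sq_sqrt h2]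
  refine mul_le_mul_of_nonneg_right ?_ h2
  nlinarith [Real.sq_sqrt hP, Real.sqrt_nonneg (8 * (2 * Lc r + 36000) + 32)]
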